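/- arXiv:2512.16566 — 3 statements merged into one kernel-verified Lean document; each statement's English description precedes it below -/
import Mathlib

section
/- Let N ≥ 3, let p, q > 0 with pq > 1, let a, b > −2, and assume the quadruple (p,q,a,b) is subcritical. Let (u,v) be a nonnegative solution of the Hénon–Lane–Emden system (HLE). If there exist R₄ > R₁ > 0, C₀ > 0 and R* > 0 such that ∫_{B_{R₄} ∖ B_{R₁}} (u_R(x)^{q+1} + v_R(x)^{p+1}) dx ≤ C₀ for every R ≥ R*, then u ≡ 0 and v ≡ 0 on ℝ^N. -/
open MeasureTheory Metric Set

noncomputable section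

/-- Euclidean space `ℝ^N`. -/
abbrev Euc (N : ℕ) := EuclideanSpace ℝ (Fin N)

/-- The Laplacian of a function `f : ℝ^N → ℝ`, as the sum of the pure second
partial derivatives. -/
def lap {N : ℕ} (f : Euc N → ℝ) (x : Euc N) : ℝ :=
  ∑ i : Fin N, iteratedFDeriv ℝ 2 f x ![EuclideanSpace.single i 1, EuclideanSpace.single i 1]

/-- `(u, v)` is a solution of the Hénon–Lane–Emden system
`-Δu = |x|^a |v|^{p-1} v`, `-Δv = |x|^b |u|^{q-1} u` on `ℝ^N \ {0}`:
`u, v` are `C²` on `ℝ^N \ {0}`, continuous on `ℝ^N`, and satisfy the equations pointwise. -/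
def IsHLESol {N : ℕ} (p q a b : ℝ) (u v : Euc N → ℝ) : Prop :=
  ContDiffOn ℝ 2 u {x : Euc N | x ≠ 0} ∧ ContDiffOn ℝ 2 v {x : Euc N | x ≠ 0} ∧
  Continuous u ∧ Continuous v ∧
  (∀ x : Euc N, x ≠ 0 → -lap u x = ‖x‖ ^ a * (|v x| ^ (p - 1) * v x)) ∧
  (∀ x : Euc N, x ≠ 0 → -lap v x = ‖x‖ ^ b * (|u x| ^ (q - 1) * u x))

/-- Stability of a (positive) solution of the Hénon–Lane–Emden system on an open set `Ω`:
there exist positive `C²` functions `ξ, ζ` on `Ω` with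
`-Δξ ≥ p |x|^a v^{p-1} ζ` and `-Δζ ≥ q |x|^b u^{q-1} ξ` on `Ω`. -/
def HLEStableOn {N : ℕ} (p q a b : ℝ) (u v : Euc N → ℝ) (Ω : Set (Euc N)) : Prop :=
  ∃ ξ ζ : Euc N → ℝ, ContDiffOn ℝ 2 ξ Ω ∧ ContDiffOn ℝ 2 ζ Ω ∧
    (∀ x ∈ Ω, 0 < ξ x) ∧ (∀ x ∈ Ω, 0 < ζ x) ∧
    (∀ x ∈ Ω, p * ‖x‖ ^ a * v x ^ (p - 1) * ζ x ≤ -lap ξ x) ∧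
    (∀ x ∈ Ω, q * ‖x‖ ^ b * u x ^ (q - 1) * ξ x ≤ -lap ζ x)

/-- Stability outside a compact set `K`: stability on every open set whose closure is
compact and contained in `ℝ^N \ K`. -/
def HLEStableOutside {N : ℕ} (p q a b : ℝ) (u v : Euc N → ℝ) (K : Set (Euc N)) : Prop :=
  IsCompact K ∧
    ∀ Ω : Set (Euc N), IsOpen Ω → IsCompact (closure Ω) → closure Ω ⊆ Kᶜ →
      HLEStableOn p q a b u v Ω

/-- `(u, v)` solves the Lane–Emden system `-Δu = |v|^{p-1} v`, `-Δv = |u|^{q-1} u` on `ℝ^N`. -/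
def IsLESol {N : ℕ} (p q : ℝ) (u v : Euc N → ℝ) : Prop :=
  (∀ x : Euc N, -lap u x = |v x| ^ (p - 1) * v x) ∧
  (∀ x : Euc N, -lap v x = |u x| ^ (q - 1) * u x)

/-- Stability of a (positive) solution of the Lane–Emden system on an open set `Ω`. -/
def LEStableOn {N : ℕ} (p q : ℝ) (u v : Euc N → ℝ) (Ω : Set (Euc N)) : Prop :=
  ∃ ξ ζ : Euc N → ℝ, ContDiffOn ℝ 2 ξ Ω ∧ ContDiffOn ℝ 2 ζ Ω ∧
    (∀ x ∈ Ω, 0 < ξ x) ∧ (∀ x ∈ Ω, 0 < ζ x) ∧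
    (∀ x ∈ Ω, p * v x ^ (p - 1) * ζ x ≤ -lap ξ x) ∧
    (∀ x ∈ Ω, q * u x ^ (q - 1) * ξ x ≤ -lap ζ x)

/-- A function on `ℝ^N` is polynomially bounded. -/
def PolyBounded {N : ℕ} (w : Euc N → ℝ) : Prop :=
  ∃ K L R : ℝ, 0 < K ∧ 0 < L ∧ ∀ x : Euc N, R ≤ ‖x‖ → |w x| ≤ K * ‖x‖ ^ L

/-- The polynomial `G` from Theorem 1.4 (iii). -/
def Gpoly (p q x : ℝ) : ℝ :=
  x ^ 4 - (4 * p * q * (q + 1) / (p + 1)) * x ^ 2 +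
    (2 * p * q * (q + 1) * (p + q + 2) / (p + 1) ^ 2) * x -
    p * q * (q + 1) ^ 2 / (p + 1) ^ 2

open Filter Topology

/-- The `C²` convex regularization of `s ↦ s ^ (-m)`: Taylor polynomial of order two on `s < 1`. -/
def prof (m s : ℝ) : ℝ :=
  if s < 1 then 1 + m * (1 - s) + m * (m + 1) / 2 * (1 - s) ^ 2 else s ^ (-m)

/-- First derivative of `prof`. -/
def prof1 (m s : ℝ) : ℝ :=
  if s < 1 then -m - m * (m + 1) * (1 - s) else -m * s ^ (-m - 1)

/-- Second derivative of `prof`. -/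
def prof2 (m s : ℝ) : ℝ :=
  if s < 1 then m * (m + 1) else m * (m + 1) * s ^ (-m - 2)

/-- The Laplacian of `z ↦ -prof m (‖z‖ ^ 2)` in dimension `2 * m + 2`, as a function of `‖z‖ ^ 2`. -/
def profLap (m s : ℝ) : ℝ := 4 * m * (m + 1) * (m + 2) * max (1 - s) 0

lemma hasDerivAt_ite_lt_one {f g : ℝ → ℝ} {f' g' : ℝ → ℝ}
    (hf : ∀ s, HasDerivAt f (f' s) s) (hg : ∀ s, 0 < s → HasDerivAt g (g' s) s)
    (h0 : f 1 = g 1) (h1 : f' 1 = g' 1) (s : ℝ) :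
    HasDerivAt (fun s => if s < 1 then f s else g s) (if s < 1 then f' s else g' s) s := by
  rcases lt_trichotomy s 1 with hs | hs | hs
  · simp only [hs, if_true]
    refine (hf s).congr_of_eventuallyEq ?_
    filter_upwards [Iio_mem_nhds hs] with r hr
    simp [show r < 1 from hr]
  · subst hs
    simp only [lt_irrefl, if_false]
    have hL : HasDerivWithinAt (fun s => if s < 1 then f s else g s) (g' 1) (Iic 1) 1 := by
      rw [← h1]
      refine (hf 1).hasDerivWithinAt.congr ?_ (by simp [h0])
      intro x hx
      rcases lt_or_eq_of_le (show x ≤ 1 from hx) with h | h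
      · simp [h]
      · simp [h, h0]
    have hR : HasDerivWithinAt (fun s => if s < 1 then f s else g s) (g' 1) (Ici 1) 1 := by
      refine (hg 1 one_pos).hasDerivWithinAt.congr ?_ (by simp)
      intro x hx
      simp [not_lt.2 (show 1 ≤ x from hx)]
    have := hL.union hR
    rwa [Iic_union_Ici, hasDerivWithinAt_univ] at this
  · simp only [not_lt.2 hs.le, if_false]
    refine (hg s (by linarith)).congr_of_eventuallyEq ?_
    filter_upwards [Ioi_mem_nhds hs] with r hr
    simp [not_lt.2 (le_of_lt (show 1 < r from hr))]

lemma hasDerivAt_prof (m s : ℝ) : HasDerivAt (prof m) (prof1 m s) s := by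
  refine hasDerivAt_ite_lt_one (f := fun s => 1 + m * (1 - s) + m * (m + 1) / 2 * (1 - s) ^ 2)
    (g := fun s => s ^ (-m)) (f' := fun s => -m - m * (m + 1) * (1 - s))
    (g' := fun s => -m * s ^ (-m - 1)) ?_ ?_ (by simp) (by simp) s
  · intro s
    have h : HasDerivAt (fun s : ℝ => 1 - s) (-1) s := by
      simpa using (hasDerivAt_id s).const_sub 1
    refine (((h.const_mul m).const_add 1).add
      ((h.pow 2).const_mul (m * (m + 1) / 2))).congr_deriv ?_
    push_cast; ring
  · intro s hs
    exact Real.hasDerivAt_rpow_const (Or.inl hs.ne')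

lemma hasDerivAt_prof1 (m s : ℝ) : HasDerivAt (prof1 m) (prof2 m s) s := by
  refine hasDerivAt_ite_lt_one (f := fun s => -m - m * (m + 1) * (1 - s))
    (g := fun s => -m * s ^ (-m - 1)) (f' := fun _ => m * (m + 1))
    (g' := fun s => m * (m + 1) * s ^ (-m - 2)) ?_ ?_ (by simp) (by simp) s
  · intro s
    have h : HasDerivAt (fun s : ℝ => 1 - s) (-1) s := by
      simpa using (hasDerivAt_id s).const_sub 1
    refine ((h.const_mul (m * (m + 1))).const_sub (-m)).congr_deriv ?_
    ring
  · intro s hs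
    refine ((Real.hasDerivAt_rpow_const (p := -m - 1) (Or.inl hs.ne')).const_mul
      (-m)).congr_deriv ?_
    rw [show -m - 1 - 1 = -m - 2 by ring]; ring

lemma prof2_eq (m s : ℝ) : prof2 m s = m * (m + 1) * (max s 1) ^ (-m - 2) := by
  unfold prof2
  split_ifs with h
  · simp [max_eq_right h.le]
  · rw [max_eq_left (not_lt.1 h)]

lemma continuous_prof2 (m : ℝ) : Continuous (prof2 m) := by
  rw [funext (prof2_eq m)]
  refine continuous_const.mul (Continuous.rpow_const (by fun_prop) ?_)
  intro x; left; positivity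

lemma prof2_nonneg {m : ℝ} (hm : 0 < m) (s : ℝ) : 0 ≤ prof2 m s := by
  rw [prof2_eq]; positivity

lemma prof_pos {m : ℝ} (hm : 0 < m) (s : ℝ) : 0 < prof m s := by
  unfold prof
  split_ifs with h
  · have : 0 < 1 - s := by linarith
    positivity
  · have : 0 < s := by linarith
    positivity

lemma prof1_nonpos {m : ℝ} (hm : 0 < m) (s : ℝ) : prof1 m s ≤ 0 := by
  unfold prof1
  split_ifs with h
  · have : 0 < m * (m + 1) * (1 - s) := by
      have : 0 < 1 - s := by linarith
      positivity
    linarith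
  · have : 0 < m * s ^ (-m - 1) := by
      have : 0 < s := by linarith
      positivity
    linarith

lemma prof_tangent {m : ℝ} (hm : 0 < m) (s r : ℝ) :
    prof m r + prof1 m r * (s - r) ≤ prof m s := by
  have hd : deriv (prof m) = prof1 m := funext fun s => (hasDerivAt_prof m s).deriv
  have hmono : Monotone (prof1 m) :=
    monotone_of_deriv_nonneg (fun s => (hasDerivAt_prof1 m s).differentiableAt)
      (fun s => by rw [(hasDerivAt_prof1 m s).deriv]; exact prof2_nonneg hm s)
  have hc : ConvexOn ℝ univ (prof m) :=
    (hd ▸ hmono).convexOn_univ_of_deriv (fun s => (hasDerivAt_prof m s).differentiableAt)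
  rcases lt_trichotomy s r with h | h | h
  · have := hc.slope_le_of_hasDerivAt (mem_univ s) (mem_univ r) h (hasDerivAt_prof m r)
    rw [slope_def_field, div_le_iff₀ (by linarith)] at this
    linarith
  · simp [h]
  · have := hc.le_slope_of_hasDerivAt (mem_univ r) (mem_univ s) h (hasDerivAt_prof m r)
    rw [slope_def_field, le_div_iff₀ (by linarith)] at this
    linarith

lemma neg_mul_prof1_le {m s : ℝ} (hm : 0 < m) : -(s * prof1 m s) ≤ m * prof m s := by
  unfold prof prof1
  split_ifs with h
  · have h1 : 0 < 1 - s := by linarith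
    have : 0 ≤ m * ((1 - s) * m + (m + 1) * (1 - s) ^ 2 + m * (m + 1) / 2 * (1 - s) ^ 2) := by
      positivity
    nlinarith [this, mul_pos hm h1]
  · have h1 : 0 < s := by linarith
    have : s * s ^ (-m - 1) = s ^ (-m) := by
      rw [Real.rpow_sub_one h1.ne']; field_simp
    nlinarith [this]

lemma neg_prof1_le {m s : ℝ} (hm : 0 < m) (hs : 0 ≤ s) :
    -prof1 m s ≤ m * (m + 2) * prof m s := by
  unfold prof prof1
  split_ifs with h
  · have h1 : 0 < 1 - s := by linarith
    have h2 : 0 ≤ m * (1 - s) + m * (m + 1) / 2 * (1 - s) ^ 2 := by positivity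
    have h3 : 0 ≤ m * (m + 2) * (m * (1 - s) + m * (m + 1) / 2 * (1 - s) ^ 2) := by positivity
    have h4 : 0 ≤ m * (m + 1) * s := by positivity
    nlinarith
  · have h1 : 1 ≤ s := by linarith
    have h2 : s ^ (-m - 1) ≤ s ^ (-m) := Real.rpow_le_rpow_of_exponent_le h1 (by linarith)
    have h3 : 0 ≤ s ^ (-m) := by positivity
    nlinarith [mul_pos hm hm, mul_nonneg (mul_pos hm hm).le h3, mul_nonneg hm.le h3]

lemma exists_prof_le {m : ℝ} (hm : 0 < m) :
    ∃ C, 0 < C ∧ ∀ s, 0 ≤ s → prof m s ≤ C * (1 + s) ^ (-m) := by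
  refine ⟨(1 + m + m * (m + 1) / 2) * 2 ^ m, by positivity, fun s hs => ?_⟩
  have hpos : (0 : ℝ) < 1 + s := by linarith
  have key : ∀ r : ℝ, 0 < r → 1 + s ≤ 2 * r → r ^ (-m) ≤ 2 ^ m * (1 + s) ^ (-m) := by
    intro r hr h
    have : (2 * r) ^ (-m) ≤ (1 + s) ^ (-m) :=
      Real.rpow_le_rpow_of_nonpos hpos h (by linarith)
    rw [Real.mul_rpow (by norm_num) hr.le, Real.rpow_neg (by norm_num)] at this
    have h2 : (0 : ℝ) < 2 ^ m := by positivity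
    calc r ^ (-m) = 2 ^ m * ((2 ^ m)⁻¹ * r ^ (-m)) := by field_simp
      _ ≤ _ := by gcongr
  unfold prof
  split_ifs with h
  · have h1 := key 1 one_pos (by linarith)
    rw [Real.one_rpow] at h1
    have h3 : 1 + m * (1 - s) + m * (m + 1) / 2 * (1 - s) ^ 2 ≤ 1 + m + m * (m + 1) / 2 := by
      have e1 : (1 - s) ≤ 1 := by linarith
      have e2 : (1 - s) ^ 2 ≤ 1 := by nlinarith
      have e3 : 0 < m * (m + 1) / 2 := by positivity
      nlinarith
    calc _ ≤ (1 + m + m * (m + 1) / 2) * 1 := by linarith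
      _ ≤ (1 + m + m * (m + 1) / 2) * (2 ^ m * (1 + s) ^ (-m)) := by gcongr
      _ = _ := by ring
  · have h1 := key s (by linarith) (by linarith)
    have h2 : 0 ≤ (m + m * (m + 1) / 2) * (2 ^ m * (1 + s) ^ (-m)) := by positivity
    nlinarith

lemma profLap_eq {m : ℝ} (s : ℝ) :
    profLap m s = -(4 * s * prof2 m s + 2 * (2 * m + 2) * prof1 m s) := by
  unfold profLap prof1 prof2
  split_ifs with h
  · rw [max_eq_left (by linarith)]; ring
  · have h1 : 0 < s := by linarith
    rw [max_eq_right (by linarith), show -m - 2 = -m - 1 - 1 by ring, Real.rpow_sub_one h1.ne']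
    field_simp
    ring

lemma rpow_mul_prof_mono {m : ℝ} (hm : 0 < m) {s r : ℝ} (hs : 0 < s) (h : s ≤ r) :
    s ^ m * prof m s ≤ r ^ m * prof m r := by
  have hd : ∀ x : ℝ, 0 < x → HasDerivAt (fun x => x ^ m * prof m x)
      (m * x ^ (m - 1) * prof m x + x ^ m * prof1 m x) x := fun x hx =>
    (Real.hasDerivAt_rpow_const (Or.inl hx.ne')).mul (hasDerivAt_prof m x)
  have : MonotoneOn (fun x => x ^ m * prof m x) (Ioi 0) := by
    refine monotoneOn_of_deriv_nonneg (convex_Ioi 0)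
      (fun x hx => (hd x hx).continuousAt.continuousWithinAt)
      (fun x hx => (hd x (by simpa using hx)).differentiableAt.differentiableWithinAt) ?_
    intro x hx
    have hx : 0 < x := by simpa using hx
    rw [(hd x hx).deriv]
    have e : x ^ m = x ^ (m - 1) * x := by
      rw [Real.rpow_sub_one hx.ne']; field_simp
    rw [e]
    have := neg_mul_prof1_le (s := x) hm
    have h2 : 0 < x ^ (m - 1) := by positivity
    nlinarith
  exact this hs (lt_of_lt_of_le hs h) h

/-- The rescaled regularized kernel, a function of the squared distance. -/
def rker (m l s : ℝ) : ℝ := l ^ m * prof m (l * s)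

/-- First derivative of `rker`. -/
def rker1 (m l s : ℝ) : ℝ := l ^ (m + 1) * prof1 m (l * s)

/-- Second derivative of `rker`. -/
def rker2 (m l s : ℝ) : ℝ := l ^ (m + 2) * prof2 m (l * s)

/-- Minus the Laplacian of `z ↦ rker m l (‖z‖ ^ 2)` in dimension `2 * m + 2`. -/
def rkerLap (m l s : ℝ) : ℝ := l ^ (m + 1) * profLap m (l * s)

section Kernel

variable {m l : ℝ}

lemma hasDerivAt_rker (hl : 0 < l) (s : ℝ) : HasDerivAt (rker m l) (rker1 m l s) s := by
  have h := ((hasDerivAt_prof m (l * s)).comp s ((hasDerivAt_id s).const_mul l)).const_mul (l ^ m)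
  refine h.congr_deriv ?_
  unfold rker1
  rw [Real.rpow_add_one hl.ne']; ring

lemma hasDerivAt_rker1 (hl : 0 < l) (s : ℝ) : HasDerivAt (rker1 m l) (rker2 m l s) s := by
  have h := ((hasDerivAt_prof1 m (l * s)).comp s
    ((hasDerivAt_id s).const_mul l)).const_mul (l ^ (m + 1))
  refine h.congr_deriv ?_
  unfold rker2
  rw [show m + 2 = m + 1 + 1 by ring, Real.rpow_add_one hl.ne' (m + 1)]; ring

lemma continuous_rker (hl : 0 < l) : Continuous (rker m l) :=
  continuous_iff_continuousAt.2 fun s => (hasDerivAt_rker hl s).continuousAt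

lemma continuous_rker1 (hl : 0 < l) : Continuous (rker1 m l) :=
  continuous_iff_continuousAt.2 fun s => (hasDerivAt_rker1 hl s).continuousAt

lemma continuous_rker2 : Continuous (rker2 m l) := by
  unfold rker2
  exact continuous_const.mul ((continuous_prof2 m).comp (by fun_prop))

lemma continuous_rkerLap : Continuous (rkerLap m l) := by
  unfold rkerLap profLap
  fun_prop

lemma rker_pos (hm : 0 < m) (hl : 0 < l) (s : ℝ) : 0 < rker m l s :=
  mul_pos (by positivity) (prof_pos hm _)

lemma rker1_nonpos (hm : 0 < m) (hl : 0 < l) (s : ℝ) : rker1 m l s ≤ 0 :=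
  mul_nonpos_of_nonneg_of_nonpos (by positivity) (prof1_nonpos hm _)

lemma rker_tangent (hm : 0 < m) (hl : 0 < l) (s r : ℝ) :
    rker m l r + rker1 m l r * (s - r) ≤ rker m l s := by
  unfold rker rker1
  have h := mul_le_mul_of_nonneg_left (prof_tangent hm (l * s) (l * r))
    (show 0 ≤ l ^ m by positivity)
  rw [Real.rpow_add_one hl.ne']
  linarith

lemma neg_mul_rker1_le (hm : 0 < m) (hl : 0 < l) (s : ℝ) :
    -(s * rker1 m l s) ≤ m * rker m l s := by
  unfold rker rker1
  have h := mul_le_mul_of_nonneg_left (neg_mul_prof1_le (s := l * s) hm)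
    (show 0 ≤ l ^ m by positivity)
  rw [Real.rpow_add_one hl.ne']
  linarith

lemma neg_rker1_le (hm : 0 < m) (hl : 0 < l) {s : ℝ} (hs : 0 ≤ s) :
    -rker1 m l s ≤ l * (m * (m + 2)) * rker m l s := by
  unfold rker rker1
  have h := mul_le_mul_of_nonneg_left (neg_prof1_le (s := l * s) hm (by positivity))
    (show 0 ≤ l ^ m * l by positivity)
  rw [Real.rpow_add_one hl.ne']
  linarith

lemma rker_mono (hm : 0 < m) (hl : 0 < l) {k s : ℝ} (hk : l ≤ k) (hs : 0 ≤ s) :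
    rker m l s ≤ rker m k s := by
  unfold rker
  rcases hs.eq_or_lt with rfl | hs
  · simp only [mul_zero]
    have := (prof_pos hm 0).le
    gcongr
  · have h := rpow_mul_prof_mono hm (mul_pos hl hs) (mul_le_mul_of_nonneg_right hk hs.le)
    have hk' : 0 < k := hl.trans_le hk
    rw [Real.mul_rpow hl.le hs.le, Real.mul_rpow hk'.le hs.le] at h
    have h2 : 0 < s ^ m := by positivity
    have : s ^ m * (l ^ m * prof m (l * s)) ≤ s ^ m * (k ^ m * prof m (k * s)) := by linarith
    exact le_of_mul_le_mul_left this h2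

lemma exists_rker_le (hm : 0 < m) (hl : 0 < l) :
    ∃ C, 0 < C ∧ ∀ s, 0 ≤ s → rker m l s ≤ C * (1 + s) ^ (-m) ∧
      -rker1 m l s * (1 + s) ≤ C * (1 + s) ^ (-m) := by
  obtain ⟨C, hC, h⟩ := exists_prof_le hm
  have hC1 : ∀ s, 0 ≤ s → rker m l s ≤ l ^ m * C * (1 + 1 / l) ^ m * (1 + s) ^ (-m) := by
    intro s hs
    have h1 := h (l * s) (by positivity)
    have h2 : (1 + s) / (1 + 1 / l) ≤ 1 + l * s := by
      rw [div_le_iff₀ (by positivity)]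
      have : (1 + l * s) * (1 + 1 / l) = 1 + s + 1 / l + l * s := by field_simp; ring
      rw [this]
      have : 0 < 1 / l := by positivity
      nlinarith [mul_nonneg hl.le hs]
    have h3 := Real.rpow_le_rpow_of_nonpos (z := -m) (by positivity) h2 (by linarith)
    rw [Real.div_rpow (by positivity) (by positivity), Real.rpow_neg (x := 1 + 1 / l)
      (by positivity), div_inv_eq_mul] at h3
    unfold rker
    calc l ^ m * prof m (l * s) ≤ l ^ m * (C * ((1 + s) ^ (-m) * (1 + 1 / l) ^ m)) := by
          gcongr
          exact h1.trans (by gcongr)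
      _ = _ := by ring
  set D := l ^ m * C * (1 + 1 / l) ^ m
  have hD : 0 < D := by positivity
  refine ⟨D * (1 + (l * (m * (m + 2)) + m)), by positivity, fun s hs => ?_⟩
  have h0 := hC1 s hs
  have hE : 0 < l * (m * (m + 2)) + m := by positivity
  have hk := rker_pos hm hl s
  have hp : 0 < D * (1 + s) ^ (-m) := by positivity
  refine ⟨by nlinarith [mul_pos hE hp], ?_⟩
  have h1 := neg_rker1_le hm hl hs
  have h2 := neg_mul_rker1_le hm hl s
  have h3 : (l * (m * (m + 2)) + m) * rker m l s ≤ (l * (m * (m + 2)) + m) * (D * (1 + s) ^ (-m)) := by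
    gcongr
  nlinarith

lemma rkerLap_eq (hl : 0 < l) (s : ℝ) :
    rkerLap m l s = -(4 * s * rker2 m l s + 2 * (2 * m + 2) * rker1 m l s) := by
  unfold rkerLap rker1 rker2
  rw [profLap_eq, show m + 2 = m + 1 + 1 by ring, Real.rpow_add_one hl.ne' (m + 1)]
  ring

lemma rkerLap_nonneg (hm : 0 < m) (hl : 0 < l) (s : ℝ) : 0 ≤ rkerLap m l s := by
  unfold rkerLap profLap
  positivity

lemma rkerLap_eq_zero {s : ℝ} (hs : 1 ≤ l * s) : rkerLap m l s = 0 := by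
  unfold rkerLap profLap
  rw [max_eq_right (by linarith)]; simp

end Kernel

/-- Logarithmic cutoffs on `(0, ∞)`. -/
structure IsLogCutoff (C : ℝ) (n : ℕ) (t t1 t2 : ℝ → ℝ) : Prop where
  deriv0 : ∀ s, HasDerivAt t (t1 s) s
  deriv1 : ∀ s, HasDerivAt t1 (t2 s) s
  cont : Continuous t2
  nonneg : ∀ s, 0 ≤ t s
  le_one : ∀ s, t s ≤ 1
  supp : ∃ c d : ℝ, 0 < c ∧ c < d ∧ ∀ s, s ∉ Icc c d → t s = 0 ∧ t1 s = 0 ∧ t2 s = 0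
  bound1 : ∀ s, |s * t1 s| ≤ C / (n + 1)
  bound2 : ∀ s, |s ^ 2 * t2 s| ≤ C / (n + 1)
  eq_one : ∀ s, 0 < s → |Real.log s| ≤ n + 1 → t s = 1

lemma exists_logCutoff : ∃ C, 0 < C ∧ ∀ n : ℕ, ∃ t t1 t2, IsLogCutoff C n t t1 t2 := by
  let ψ : ContDiffBump (0 : ℝ) := ⟨1, 2, by norm_num, by norm_num⟩
  have hψ : ContDiff ℝ 3 (ψ : ℝ → ℝ) := ψ.contDiff
  have hψ1 : ContDiff ℝ 2 (deriv ψ) := ((contDiff_succ_iff_deriv (n := 2)).1 hψ).2.2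
  have hψ2 : ContDiff ℝ 1 (deriv (deriv ψ)) := ((contDiff_succ_iff_deriv (n := 1)).1 hψ1).2.2
  have hs0 : HasCompactSupport (ψ : ℝ → ℝ) := ψ.hasCompactSupport
  obtain ⟨C1, hC1⟩ := hs0.deriv.exists_bound_of_continuous hψ1.continuous
  obtain ⟨C2, hC2⟩ := hs0.deriv.deriv.exists_bound_of_continuous hψ2.continuous
  have hC10 : 0 ≤ C1 := (norm_nonneg _).trans (hC1 0)
  have hC20 : 0 ≤ C2 := (norm_nonneg _).trans (hC2 0)
  have hd0 : ∀ x, HasDerivAt ψ (deriv ψ x) x := fun x =>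
    (hψ.differentiable (by norm_num) x).hasDerivAt
  have hd1 : ∀ x, HasDerivAt (deriv ψ) (deriv (deriv ψ) x) x := fun x =>
    (hψ1.differentiable (by norm_num) x).hasDerivAt
  have hz0 : ∀ x, 2 < |x| → ψ x = 0 := fun x hx => ψ.zero_of_le_dist (by simpa using hx.le)
  have hop : IsOpen {x : ℝ | 2 < |x|} := isOpen_lt continuous_const continuous_abs
  have hz1 : ∀ x, 2 < |x| → deriv ψ x = 0 := fun x hx => by
    have : (ψ : ℝ → ℝ) =ᶠ[𝓝 x] fun _ => 0 := by
      filter_upwards [hop.mem_nhds hx] with y hy using hz0 y hy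
    simpa using this.deriv_eq
  have hz2 : ∀ x, 2 < |x| → deriv (deriv ψ) x = 0 := fun x hx => by
    have : deriv (ψ : ℝ → ℝ) =ᶠ[𝓝 x] fun _ => 0 := by
      filter_upwards [hop.mem_nhds hx] with y hy using hz1 y hy
    simpa using this.deriv_eq
  refine ⟨C1 + C2 + 1, by positivity, fun n => ?_⟩
  set k : ℝ := n + 1 with hk
  have hk1 : 1 ≤ k := by rw [hk]; linarith [(Nat.cast_nonneg n : (0 : ℝ) ≤ n)]
  have hk0 : 0 < k := by linarith
  have big : ∀ s, 0 < s → s ∉ Icc (Real.exp (-(3 * k))) (Real.exp (3 * k)) →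
      2 < |Real.log s / k| := by
    intro s hs hns
    rw [abs_div, abs_of_pos hk0, lt_div_iff₀ hk0]
    by_contra hcon
    apply hns
    have := abs_le.1 (not_lt.1 hcon)
    rw [mem_Icc, ← Real.le_log_iff_exp_le hs, ← Real.log_le_iff_le_exp hs]
    constructor <;> linarith
  have glue : ∀ (φ φ' : ℝ → ℝ),
      (∀ s, 0 < s → s ∉ Icc (Real.exp (-(3 * k))) (Real.exp (3 * k)) → φ s = 0) →
      (∀ s, 0 < s → HasDerivAt φ (φ' s) s) →
      ∀ s, HasDerivAt (fun s => if 0 < s then φ s else 0) (if 0 < s then φ' s else 0) s := by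
    intro φ φ' h0 h1 s
    by_cases hs : 0 < s
    · simp only [hs, if_true]
      refine (h1 s hs).congr_of_eventuallyEq ?_
      filter_upwards [Ioi_mem_nhds hs] with r hr
      simp [show 0 < r from hr]
    · simp only [hs, if_false]
      refine (hasDerivAt_const s (0 : ℝ)).congr_of_eventuallyEq ?_
      filter_upwards [Iio_mem_nhds (lt_of_le_of_lt (not_lt.1 hs) (Real.exp_pos (-(3 * k))))]
        with r hr
      split_ifs with h
      · exact h0 r h (fun h' => absurd h'.1 (not_le.2 hr))
      · rfl
  have hlog : ∀ s : ℝ, 0 < s → HasDerivAt (fun s => Real.log s / k) (s⁻¹ / k) s := fun s hs =>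
    (Real.hasDerivAt_log hs.ne').div_const k
  have hA : ∀ s, 0 < s → HasDerivAt (fun s => ψ (Real.log s / k))
      (deriv ψ (Real.log s / k) * (s⁻¹ / k)) s := fun s hs =>
    (hd0 _).comp s (hlog s hs)
  have hB : ∀ s, 0 < s → HasDerivAt (fun s => deriv ψ (Real.log s / k) * (s⁻¹ / k))
      (deriv (deriv ψ) (Real.log s / k) * (s⁻¹ / k) * (s⁻¹ / k) +
        deriv ψ (Real.log s / k) * (-(s ^ 2)⁻¹ / k)) s := fun s hs =>
    ((hd1 _).comp s (hlog s hs)).mul ((hasDerivAt_inv hs.ne').div_const k)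
  refine ⟨fun s => if 0 < s then ψ (Real.log s / k) else 0,
    fun s => if 0 < s then deriv ψ (Real.log s / k) * (s⁻¹ / k) else 0,
    fun s => if 0 < s then deriv (deriv ψ) (Real.log s / k) * (s⁻¹ / k) * (s⁻¹ / k) +
        deriv ψ (Real.log s / k) * (-(s ^ 2)⁻¹ / k) else 0, ?_⟩
  have hkk : k ≤ k ^ 2 := by nlinarith
  constructor
  · exact glue _ _ (fun s hs h => hz0 _ (big s hs h)) hA
  · exact glue _ _ (fun s hs h => by rw [hz1 _ (big s hs h), zero_mul]) hB
  · rw [continuous_iff_continuousAt]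
    intro s
    by_cases hs : 0 < s
    · have hc : ContinuousAt (fun s => deriv (deriv ψ) (Real.log s / k) * (s⁻¹ / k) * (s⁻¹ / k) +
        deriv ψ (Real.log s / k) * (-(s ^ 2)⁻¹ / k)) s := by
        have l1 := (hlog s hs).continuousAt
        have l2 := hψ2.continuous.continuousAt.comp l1
        have l3 := hψ1.continuous.continuousAt.comp l1
        have l4 : ContinuousAt (fun s : ℝ => s⁻¹ / k) s :=
          (continuousAt_inv₀ hs.ne').div_const k
        have l5 : ContinuousAt (fun s : ℝ => -(s ^ 2)⁻¹ / k) s :=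
          (((continuousAt_id.pow 2).inv₀ (by simpa using hs.ne')).neg).div_const k
        exact ((l2.mul l4).mul l4).add (l3.mul l5)
      refine hc.congr ?_
      filter_upwards [Ioi_mem_nhds hs] with r hr
      simp [show 0 < r from hr]
    · refine (continuousAt_const (y := (0 : ℝ))).congr ?_
      filter_upwards [Iio_mem_nhds (lt_of_le_of_lt (not_lt.1 hs) (Real.exp_pos (-(3 * k))))]
        with r hr
      split_ifs with h
      · have := big r h (fun h' => absurd h'.1 (not_le.2 hr))
        rw [hz1 _ this, hz2 _ this]; simp
      · rfl
  · intro s; split_ifs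
    · exact ψ.nonneg
    · exact le_rfl
  · intro s; split_ifs
    · exact ψ.le_one
    · exact zero_le_one
  · refine ⟨Real.exp (-(3 * k)), Real.exp (3 * k), Real.exp_pos _,
      Real.exp_lt_exp.2 (by linarith), fun s hs => ?_⟩
    by_cases h : 0 < s
    · have := big s h hs
      simp only [h, if_true]
      rw [hz0 _ this, hz1 _ this, hz2 _ this]; simp
    · simp [h]
  · intro s
    by_cases h : 0 < s
    · simp only [h, if_true]
      rw [show s * (deriv ψ (Real.log s / k) * (s⁻¹ / k)) = deriv ψ (Real.log s / k) / k by
        field_simp, abs_div, abs_of_pos hk0]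
      have := hC1 (Real.log s / k)
      rw [Real.norm_eq_abs] at this
      gcongr
      linarith
    · simp only [h, if_false, mul_zero, abs_zero]; positivity
  · intro s
    by_cases h : 0 < s
    · simp only [h, if_true]
      have e : s ^ 2 * (deriv (deriv ψ) (Real.log s / k) * (s⁻¹ / k) * (s⁻¹ / k) +
        deriv ψ (Real.log s / k) * (-(s ^ 2)⁻¹ / k)) =
          deriv (deriv ψ) (Real.log s / k) / k ^ 2 - deriv ψ (Real.log s / k) / k := by
        field_simp
        ring
      rw [e]
      have h1 := hC1 (Real.log s / k)
      have h2 := hC2 (Real.log s / k)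
      rw [Real.norm_eq_abs] at h1 h2
      calc _ ≤ |deriv (deriv ψ) (Real.log s / k) / k ^ 2| + |deriv ψ (Real.log s / k) / k| :=
            abs_sub _ _
        _ = |deriv (deriv ψ) (Real.log s / k)| / k ^ 2 + |deriv ψ (Real.log s / k)| / k := by
            rw [abs_div, abs_div, abs_of_pos hk0, abs_of_pos (pow_pos hk0 2)]
        _ ≤ C2 / k + C1 / k := by gcongr
        _ ≤ _ := by rw [← add_div]; exact div_le_div_of_nonneg_right (by linarith) hk0.le
    · simp only [h, if_false, mul_zero, abs_zero]; positivity
  · intro s hs hl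
    simp only [hs, if_true]
    refine ψ.one_of_mem_closedBall ?_
    rw [mem_closedBall, dist_zero_right, Real.norm_eq_abs, abs_div, abs_of_pos hk0]
    exact (div_le_one hk0).2 hl

section Annulus

variable {N : ℕ}

lemma isOpen_ne_zero : IsOpen {x : Euc N | x ≠ 0} := isOpen_ne

lemma isCompact_annulus (c d : ℝ) : IsCompact {x : Euc N | ‖x‖ ^ 2 ∈ Icc c d} := by
  refine Metric.isCompact_of_isClosed_isBounded
    (isClosed_Icc.preimage (by fun_prop : Continuous fun x : Euc N => ‖x‖ ^ 2)) ?_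
  refine (Metric.isBounded_closedBall (x := (0 : Euc N)) (r := 1 + |d|)).subset fun x hx => ?_
  rw [mem_closedBall, dist_zero_right]
  have h1 : ‖x‖ ^ 2 ≤ |d| := hx.2.trans (le_abs_self d)
  nlinarith [norm_nonneg x, abs_nonneg d]

lemma annulus_subset {c d : ℝ} (hc : 0 < c) :
    {x : Euc N | ‖x‖ ^ 2 ∈ Icc c d} ⊆ {x : Euc N | x ≠ 0} := by
  rintro x hx rfl
  have := hx.1
  simp at this
  linarith

lemma integrable_of_annulus {φ : Euc N → ℝ} {c d : ℝ} (hc : 0 < c)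
    (hφ : ContinuousOn φ {x | x ≠ 0}) (h0 : ∀ x, ‖x‖ ^ 2 ∉ Icc c d → φ x = 0) :
    Integrable φ := by
  have h1 : IntegrableOn φ {x : Euc N | ‖x‖ ^ 2 ∈ Icc c d} :=
    (hφ.mono (annulus_subset hc)).integrableOn_compact (isCompact_annulus c d)
  rwa [integrableOn_iff_integrable_of_support_subset] at h1
  intro x hx
  by_contra hcon
  exact hx (h0 x hcon)

lemma integral_lineDeriv_eq_zero {φ φ' : Euc N → ℝ} {e : Euc N} {c d : ℝ} (hc : 0 < c)
    (hφ : ContinuousOn φ {x | x ≠ 0}) (hφ' : ContinuousOn φ' {x | x ≠ 0})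
    (h0 : ∀ x, ‖x‖ ^ 2 ∉ Icc c d → φ x = 0) (h0' : ∀ x, ‖x‖ ^ 2 ∉ Icc c d → φ' x = 0)
    (hd : ∀ x, x ≠ 0 → HasLineDerivAt ℝ φ (φ' x) x e) :
    Integrable φ' ∧ ∫ x, φ' x = 0 := by
  have hi := integrable_of_annulus hc hφ h0
  have hi' := integrable_of_annulus hc hφ' h0'
  refine ⟨hi', ?_⟩
  have key := integral_bilinear_hasLineDerivAt_right_eq_neg_left_of_integrable
    (μ := (volume : Measure (Euc N))) (f := fun _ => (1 : ℝ)) (f' := fun _ => (0 : ℝ)) (g := φ)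
    (g' := φ') (v := e) (B := ContinuousLinearMap.mul ℝ ℝ) (by simp) (by simpa using hi')
    (by simpa using hi) (fun x _ => hasDerivAt_const (0 : ℝ) (1 : ℝ)) ?_
  · simpa using key
  intro x _
  by_cases hx : x = 0
  · subst hx
    have hev : φ =ᶠ[𝓝 0] fun _ => 0 := by
      have : {x : Euc N | ‖x‖ ^ 2 < c} ∈ 𝓝 (0 : Euc N) := by
        refine (isOpen_lt (by fun_prop) continuous_const).mem_nhds ?_
        simpa using hc
      filter_upwards [this] with y hy
      exact h0 y fun h => absurd h.1 (not_le.2 hy)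
    have : φ' 0 = 0 := h0' 0 fun h => by
      have := h.1
      simp at this
      linarith
    rw [this]
    have h : HasFDerivAt φ (0 : Euc N →L[ℝ] ℝ) 0 :=
      (hasFDerivAt_const (0 : ℝ) (0 : Euc N)).congr_of_eventuallyEq hev
    have h2 := h.hasLineDerivAt (e : Euc N)
    simpa using h2
  · exact hd x hx

lemma norm_add_smul_single_sq (z : Euc N) (i : Fin N) (t : ℝ) :
    ‖z + t • EuclideanSpace.single i (1 : ℝ)‖ ^ 2 = ‖z‖ ^ 2 + 2 * t * z i + t ^ 2 := by
  rw [norm_add_sq_real, inner_smul_right, norm_smul]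
  have : inner ℝ z (EuclideanSpace.single i (1 : ℝ)) = z i := by
    simp [EuclideanSpace.inner_single_right]
  rw [this]
  simp
  ring

lemma sum_sq_eq (z : Euc N) : ∑ i, z i ^ 2 = ‖z‖ ^ 2 := by
  rw [EuclideanSpace.norm_sq_eq]
  simp

lemma sum_mul_eq_inner (z w : Euc N) : ∑ i, z i * w i = inner ℝ z w := by
  simp [PiLp.inner_apply, mul_comm]

lemma hasLineDerivAt_radial {k k1 : ℝ → ℝ} (hk : ∀ s, HasDerivAt k (k1 s) s) (x y : Euc N)
    (i : Fin N) :
    HasLineDerivAt ℝ (fun y => k (‖y - x‖ ^ 2)) (2 * k1 (‖y - x‖ ^ 2) * (y i - x i)) y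
      (EuclideanSpace.single i (1 : ℝ)) := by
  unfold HasLineDerivAt
  have e : ∀ t : ℝ, ‖y + t • EuclideanSpace.single i (1 : ℝ) - x‖ ^ 2 =
      ‖y - x‖ ^ 2 + 2 * t * (y i - x i) + t ^ 2 := fun t => by
    rw [add_sub_right_comm, norm_add_smul_single_sq]; rfl
  simp only [e]
  have h1 : HasDerivAt (fun t : ℝ => ‖y - x‖ ^ 2 + 2 * t * (y i - x i) + t ^ 2)
      (2 * (y i - x i)) 0 := by
    have := ((((hasDerivAt_id (0 : ℝ)).const_mul 2).mul_const (y i - x i)).const_add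
      (‖y - x‖ ^ 2)).add ((hasDerivAt_id (0 : ℝ)).pow 2)
    refine this.congr_deriv ?_
    simp
  have h2 : HasDerivAt k (k1 (‖y - x‖ ^ 2)) (‖y - x‖ ^ 2 + 2 * 0 * (y i - x i) + 0 ^ 2) := by
    simpa using hk (‖y - x‖ ^ 2)
  exact (h2.comp 0 h1).congr_deriv (by ring)

lemma hasLineDerivAt_coord (x y : Euc N) (i : Fin N) :
    HasLineDerivAt ℝ (fun y => y i - x i) 1 y (EuclideanSpace.single i (1 : ℝ)) := by
  unfold HasLineDerivAt
  have : (fun t : ℝ => (y + t • EuclideanSpace.single i (1 : ℝ)) i - x i) =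
      fun t => y i + t - x i := by
    ext t; simp
  rw [this]
  exact ((hasDerivAt_id (0 : ℝ)).const_add (y i)).sub_const (x i)

lemma HasLineDerivAt.mul_real {f g : Euc N → ℝ} {f' g' : ℝ} {y e : Euc N}
    (hf : HasLineDerivAt ℝ f f' y e) (hg : HasLineDerivAt ℝ g g' y e) :
    HasLineDerivAt ℝ (fun y => f y * g y) (f' * g y + f y * g') y e := by
  unfold HasLineDerivAt at *
  refine (HasDerivAt.mul hf hg).congr_deriv ?_
  simp

/-- Green's identity for a `C²` function off the origin against a radial kernel times a cutoff. -/
lemma green_annulus {w : Euc N → ℝ} (hw : ContDiffOn ℝ 2 w {x | x ≠ 0})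
    {k k1 k2 : ℝ → ℝ} (hk : ∀ s, HasDerivAt k (k1 s) s) (hk1 : ∀ s, HasDerivAt k1 (k2 s) s)
    (hk2 : Continuous k2) {t t1 t2 : ℝ → ℝ} {C : ℝ} {n : ℕ} (ht : IsLogCutoff C n t t1 t2)
    (x : Euc N) :
    ∫ y, (k (‖y - x‖ ^ 2) * t (‖y‖ ^ 2) * lap w y -
      w y * (t (‖y‖ ^ 2) * (4 * ‖y - x‖ ^ 2 * k2 (‖y - x‖ ^ 2) + 2 * N * k1 (‖y - x‖ ^ 2)) +
        8 * k1 (‖y - x‖ ^ 2) * t1 (‖y‖ ^ 2) * inner ℝ (y - x) y +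
        k (‖y - x‖ ^ 2) * (4 * ‖y‖ ^ 2 * t2 (‖y‖ ^ 2) + 2 * N * t1 (‖y‖ ^ 2)))) = 0 := by
  obtain ⟨c, d, hc, hcd, hz⟩ := ht.supp
  have kc : Continuous k := continuous_iff_continuousAt.2 fun s => (hk s).continuousAt
  have k1c : Continuous k1 := continuous_iff_continuousAt.2 fun s => (hk1 s).continuousAt
  have tc : Continuous t := continuous_iff_continuousAt.2 fun s => (ht.deriv0 s).continuousAt
  have t1c : Continuous t1 := continuous_iff_continuousAt.2 fun s => (ht.deriv1 s).continuousAt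
  have t2c := ht.cont
  have hwc : ContinuousOn w {x | x ≠ 0} := hw.continuousOn
  have hw1 : ContDiffOn ℝ 1 (fderiv ℝ w) {x | x ≠ 0} :=
    hw.fderiv_of_isOpen isOpen_ne_zero (by norm_num)
  have hw2 : ContDiffOn ℝ 0 (fderiv ℝ (fderiv ℝ w)) {x | x ≠ 0} :=
    hw1.fderiv_of_isOpen isOpen_ne_zero (by norm_num)
  let e : Fin N → Euc N := fun i => EuclideanSpace.single i 1
  have hw1c : ∀ i, ContinuousOn (fun y => fderiv ℝ w y (e i)) {x | x ≠ 0} := fun i =>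
    hw1.continuousOn.clm_apply continuousOn_const
  have hw2c : ∀ i, ContinuousOn (fun y => fderiv ℝ (fderiv ℝ w) y (e i) (e i)) {x | x ≠ 0} :=
    fun i => (hw2.continuousOn.clm_apply continuousOn_const).clm_apply continuousOn_const
  have hwd : ∀ i y, y ≠ 0 → HasLineDerivAt ℝ w (fderiv ℝ w y (e i)) y (e i) := fun i y hy =>
    ((hw.differentiableOn (by norm_num)).differentiableAt
      (isOpen_ne_zero.mem_nhds hy)).hasFDerivAt.hasLineDerivAt _
  have hwdd : ∀ i y, y ≠ 0 → HasLineDerivAt ℝ (fun y => fderiv ℝ w y (e i))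
      (fderiv ℝ (fderiv ℝ w) y (e i) (e i)) y (e i) := fun i y hy => by
    have h1 := ((hw1.differentiableOn (by norm_num)).differentiableAt
      (isOpen_ne_zero.mem_nhds hy)).hasFDerivAt
    have h2 := (h1.clm_apply (hasFDerivAt_const (e i) y)).hasLineDerivAt (e i)
    simpa using h2
  let P : Euc N → ℝ := fun y => k (‖y - x‖ ^ 2) * t (‖y‖ ^ 2)
  let P1 : Fin N → Euc N → ℝ := fun i y =>
    2 * k1 (‖y - x‖ ^ 2) * (y i - x i) * t (‖y‖ ^ 2) +
      k (‖y - x‖ ^ 2) * (2 * t1 (‖y‖ ^ 2) * y i)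
  let P2 : Fin N → Euc N → ℝ := fun i y =>
    (4 * k2 (‖y - x‖ ^ 2) * (y i - x i) ^ 2 + 2 * k1 (‖y - x‖ ^ 2)) * t (‖y‖ ^ 2) +
      8 * k1 (‖y - x‖ ^ 2) * t1 (‖y‖ ^ 2) * ((y i - x i) * y i) +
      k (‖y - x‖ ^ 2) * (4 * t2 (‖y‖ ^ 2) * y i ^ 2 + 2 * t1 (‖y‖ ^ 2))
  have hrad : ∀ {φ φ' : ℝ → ℝ}, (∀ s, HasDerivAt φ (φ' s) s) → ∀ i (y : Euc N),
      HasLineDerivAt ℝ (fun y => φ (‖y‖ ^ 2)) (2 * φ' (‖y‖ ^ 2) * y i) y (e i) := by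
    intro φ φ' h i y
    simpa using hasLineDerivAt_radial h 0 y i
  have hP : ∀ i y, HasLineDerivAt ℝ P (P1 i y) y (e i) := fun i y =>
    (hasLineDerivAt_radial hk x y i).mul_real (hrad ht.deriv0 i y)
  have hco0 : ∀ i (y : Euc N), HasLineDerivAt ℝ (fun y => y i) 1 y (e i) := fun i y => by
    simpa using hasLineDerivAt_coord 0 y i
  have hP1 : ∀ i y, HasLineDerivAt ℝ (P1 i) (P2 i y) y (e i) := fun i y => by
    have a1 := ((hasLineDerivAt_radial hk1 x y i).mul_real
      (hasLineDerivAt_coord x y i)).mul_real (hrad ht.deriv0 i y)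
    have a2 := (hasLineDerivAt_radial hk x y i).mul_real
      ((hrad ht.deriv1 i y).mul_real (hco0 i y))
    have a3 := (HasDerivAt.const_mul 2 a1).add (HasDerivAt.const_mul 2 a2)
    unfold HasLineDerivAt
    refine (a3.congr_of_eventuallyEq (Eventually.of_forall fun s => ?_)).congr_deriv ?_
    · simp only [P1, Pi.add_apply]; ring
    · simp only [P2]; ring
  have hTz : ∀ y : Euc N, ‖y‖ ^ 2 ∉ Icc c d →
      t (‖y‖ ^ 2) = 0 ∧ t1 (‖y‖ ^ 2) = 0 ∧ t2 (‖y‖ ^ 2) = 0 := fun y hy => hz _ hy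
  have hcy : ∀ i, Continuous fun y : Euc N => y i := fun i => by fun_prop
  have Pc : Continuous P := by fun_prop
  have P1c : ∀ i, Continuous (P1 i) := fun i => by fun_prop
  have P2c : ∀ i, Continuous (P2 i) := fun i => by fun_prop
  have main : ∀ i, Integrable (fun y => P y * fderiv ℝ (fderiv ℝ w) y (e i) (e i) - w y * P2 i y) ∧
      ∫ y, (P y * fderiv ℝ (fderiv ℝ w) y (e i) (e i) - w y * P2 i y) = 0 := by
    intro i
    refine integral_lineDeriv_eq_zero (e := e i) hc (d := d)
      (φ := fun y => P y * fderiv ℝ w y (e i) - w y * P1 i y)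
      ((Pc.continuousOn.mul (hw1c i)).sub (hwc.mul (P1c i).continuousOn))
      ((Pc.continuousOn.mul (hw2c i)).sub (hwc.mul (P2c i).continuousOn)) ?_ ?_ ?_
    · intro y hy
      obtain ⟨z0, z1, z2⟩ := hTz y hy
      simp [P, P1, z0, z1]
    · intro y hy
      obtain ⟨z0, z1, z2⟩ := hTz y hy
      simp [P, P2, z0, z1, z2]
    · intro y hy
      have a1 := (hP i y).mul_real (hwdd i y hy)
      have a2 := (hwd i y hy).mul_real (hP1 i y)
      unfold HasLineDerivAt at *
      exact (a1.sub a2).congr_deriv (by ring)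
  have hsum : ∫ y, ∑ i, (P y * fderiv ℝ (fderiv ℝ w) y (e i) (e i) - w y * P2 i y) = 0 := by
    rw [integral_finsetSum _ fun i _ => (main i).1]
    exact Finset.sum_eq_zero fun i _ => (main i).2
  rw [← hsum]
  congr 1
  ext y
  have hl : lap w y = ∑ i, fderiv ℝ (fderiv ℝ w) y (e i) (e i) := by
    simp [lap, iteratedFDeriv_two_apply, e]
  rw [Finset.sum_sub_distrib, ← Finset.mul_sum, ← Finset.mul_sum, ← hl]
  congr 2
  simp only [P2, Finset.sum_add_distrib, ← Finset.mul_sum, ← Finset.sum_mul]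
  have s1 : ∑ i, (y i - x i) ^ 2 = ‖y - x‖ ^ 2 := sum_sq_eq (y - x)
  have s2 : ∑ i, (y i - x i) * y i = inner ℝ (y - x) y := sum_mul_eq_inner (y - x) y
  rw [s1, s2, sum_sq_eq]
  simp
  ring

end Annulus

section Representation

/-- A nonnegative function whose products with cutoffs tending to one have convergent integrals
is integrable, and the limit is its integral. -/
lemma integrable_and_integral_eq_of_tendsto_cutoff {X : Type*} [MeasurableSpace X] {μ : Measure X}
    {h : X → ℝ} {τ : ℕ → X → ℝ} {L : ℝ} (hm : AEStronglyMeasurable h μ) (h0 : ∀ x, 0 ≤ h x)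
    (hi : ∀ n, Integrable (fun x => h x * τ n x) μ) (τ0 : ∀ n x, 0 ≤ τ n x)
    (τ1 : ∀ n x, τ n x ≤ 1) (hτ : ∀ᵐ x ∂μ, Tendsto (fun n => τ n x) atTop (𝓝 1))
    (hL : Tendsto (fun n => ∫ x, h x * τ n x ∂μ) atTop (𝓝 L)) :
    Integrable h μ ∧ ∫ x, h x ∂μ = L := by
  have hlim : ∀ᵐ x ∂μ, Tendsto (fun n => h x * τ n x) atTop (𝓝 (h x)) := by
    filter_upwards [hτ] with x hx
    simpa using hx.const_mul (h x)
  have hInt : Integrable h μ := by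
    refine ⟨hm, ?_⟩
    have e1 : ∫⁻ x, ‖h x‖ₑ ∂μ = ∫⁻ x, liminf (fun n => ‖h x * τ n x‖ₑ) atTop ∂μ :=
      lintegral_congr_ae (by filter_upwards [hlim] with x hx using hx.enorm.liminf_eq.symm)
    have e2 : ∀ n, ∫⁻ x, ‖h x * τ n x‖ₑ ∂μ = ENNReal.ofReal (∫ x, h x * τ n x ∂μ) := fun n => by
      rw [ofReal_integral_eq_lintegral_ofReal (hi n)
        (Eventually.of_forall fun x => mul_nonneg (h0 x) (τ0 n x))]
      refine lintegral_congr fun x => ?_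
      rw [Real.enorm_eq_ofReal (mul_nonneg (h0 x) (τ0 n x))]
    have e3 : ∫⁻ x, ‖h x‖ₑ ∂μ ≤ ENNReal.ofReal L := by
      rw [e1]
      refine (lintegral_liminf_le' fun n => (hi n).1.aemeasurable.enorm).trans ?_
      simp only [e2]
      exact ((ENNReal.continuous_ofReal.tendsto L).comp hL).liminf_eq.le
    exact e3.trans_lt ENNReal.ofReal_lt_top
  refine ⟨hInt, tendsto_nhds_unique ?_ hL⟩
  refine tendsto_integral_of_dominated_convergence h (fun n => (hi n).1) hInt (fun n => ?_) hlim
  refine Eventually.of_forall fun x => ?_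
  rw [Real.norm_of_nonneg (mul_nonneg (h0 x) (τ0 n x))]
  exact mul_le_of_le_one_right (h0 x) (τ1 n x)

variable {N : ℕ}

lemma ae_ne_zero (hN : 0 < N) : ∀ᵐ x : Euc N, x ≠ 0 := by
  have : NeZero N := ⟨hN.ne'⟩
  have : Nontrivial (Euc N) := by
    refine ⟨EuclideanSpace.single 0 1, 0, fun h => ?_⟩
    simpa using congrArg norm h
  exact compl_mem_ae_iff.2 (measure_singleton 0)

lemma aestronglyMeasurable_of_continuousOn (hN : 0 < N) {g : Euc N → ℝ}
    (hg : ContinuousOn g {x | x ≠ 0}) : AEStronglyMeasurable g volume := by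
  have h := hg.aestronglyMeasurable (μ := volume) isOpen_ne_zero.measurableSet
  rwa [Measure.restrict_eq_self_of_ae_mem] at h
  exact ae_ne_zero hN

lemma IsLogCutoff.tendsto_one {C : ℝ} {t t1 t2 : ℕ → ℝ → ℝ}
    (ht : ∀ n, IsLogCutoff C n (t n) (t1 n) (t2 n)) {s : ℝ} (hs : 0 < s) :
    Tendsto (fun n => t n s) atTop (𝓝 1) := by
  obtain ⟨k, hk⟩ := exists_nat_ge |Real.log s|
  refine tendsto_const_nhds.congr' ?_
  filter_upwards [eventually_ge_atTop k] with n hn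
  refine ((ht n).eq_one s hs ?_).symm
  have : (k : ℝ) ≤ n := by exact_mod_cast hn
  linarith

lemma norm_sq_pos {x : Euc N} (hx : x ≠ 0) : 0 < ‖x‖ ^ 2 := by positivity

/-- The error terms in Green's identity produced by a logarithmic cutoff. -/
lemma abs_green_error_le {m l : ℝ} (hm : 0 < m) (hl : 0 < l) (C : ℝ) (hC : 0 < C) (x : Euc N) :
    ∃ D, 0 < D ∧ ∀ (n : ℕ) (t t1 t2 : ℝ → ℝ), IsLogCutoff C n t t1 t2 → ∀ y : Euc N, y ≠ 0 →
      |8 * rker1 m l (‖y - x‖ ^ 2) * t1 (‖y‖ ^ 2) * inner ℝ (y - x) y +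
        rker m l (‖y - x‖ ^ 2) * (4 * ‖y‖ ^ 2 * t2 (‖y‖ ^ 2) + 2 * N * t1 (‖y‖ ^ 2))| ≤
      D / (n + 1) * ((‖y‖ ^ 2)⁻¹ * (1 + ‖y‖ ^ 2) ^ (-m)) := by
  obtain ⟨K, hK, hker⟩ := exists_rker_le hm hl
  set Xn := ‖x‖ with hXn
  have hX : 0 ≤ Xn := norm_nonneg x
  refine ⟨C * (8 * K * (1 + Xn) + K * (4 + 2 * N)) * (2 * (1 + Xn ^ 2)) ^ m, by positivity, ?_⟩
  intro n t t1 t2 ht y hy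
  set S := ‖y - x‖ ^ 2 with hS
  set T := ‖y‖ ^ 2 with hT
  have hS0 : 0 ≤ S := by positivity
  have hTp : 0 < T := norm_sq_pos hy
  set δ := C / ((n : ℝ) + 1) with hδ
  have hδ0 : 0 < δ := by positivity
  have b1 : |t1 T| ≤ δ * T⁻¹ := by
    have := ht.bound1 T
    rw [abs_mul, abs_of_pos hTp] at this
    rw [← div_eq_mul_inv, le_div_iff₀ hTp]; linarith
  have b2 : |T * t2 T| ≤ δ * T⁻¹ := by
    have := ht.bound2 T
    rw [pow_two, mul_assoc, abs_mul, abs_of_pos hTp] at this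
    rw [← div_eq_mul_inv, le_div_iff₀ hTp]; linarith
  obtain ⟨k0, k1⟩ := hker S hS0
  have kp := rker_pos hm hl S
  have k1n := rker1_nonpos hm hl S
  have hyle : ‖y‖ ≤ ‖y - x‖ + Xn := by
    simpa using norm_add_le (y - x) x
  have hi : |inner ℝ (y - x) y| ≤ (1 + Xn) * (1 + S) := by
    refine (abs_real_inner_le_norm _ _).trans ?_
    have h0 := norm_nonneg (y - x)
    nlinarith [mul_le_mul_of_nonneg_left hyle h0, sq_nonneg (‖y - x‖ - 1),
      mul_nonneg hX (sq_nonneg (‖y - x‖ - 1)), mul_nonneg hX h0]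
  have hP : (1 + S) ^ (-m) ≤ (2 * (1 + Xn ^ 2)) ^ m * (1 + T) ^ (-m) := by
    have hle : 1 + T ≤ 2 * (1 + Xn ^ 2) * (1 + S) := by
      have : T ≤ 2 * S + 2 * Xn ^ 2 := by
        rw [hT, hS]
        nlinarith [norm_nonneg y, sq_nonneg (‖y - x‖ - Xn), norm_nonneg (y - x)]
      nlinarith [mul_nonneg hS0 (sq_nonneg Xn)]
    have h1 : (1 + T) ^ m ≤ (2 * (1 + Xn ^ 2)) ^ m * (1 + S) ^ m := by
      rw [← Real.mul_rpow (by positivity) (by positivity)]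
      exact Real.rpow_le_rpow (by positivity) hle hm.le
    rw [Real.rpow_neg (by positivity), Real.rpow_neg (by positivity), ← div_eq_mul_inv,
      inv_eq_one_div, div_le_div_iff₀ (by positivity) (by positivity)]
    linarith
  set P := (1 + S) ^ (-m) with hPdef
  have hP0 : 0 < P := by positivity
  have e1 : |8 * rker1 m l S * t1 T * inner ℝ (y - x) y| ≤ 8 * K * (1 + Xn) * P * (δ * T⁻¹) := by
    rw [abs_mul, abs_mul, abs_mul, abs_of_pos (by norm_num : (0 : ℝ) < 8), abs_of_nonpos k1n]
    calc 8 * -rker1 m l S * |t1 T| * |inner ℝ (y - x) y|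
        ≤ 8 * -rker1 m l S * |t1 T| * ((1 + Xn) * (1 + S)) := by
          refine mul_le_mul_of_nonneg_left hi ?_
          have := abs_nonneg (t1 T)
          exact mul_nonneg (by linarith) this
      _ = 8 * (1 + Xn) * (-rker1 m l S * (1 + S)) * |t1 T| := by ring
      _ ≤ 8 * (1 + Xn) * (K * P) * (δ * T⁻¹) := by gcongr
      _ = _ := by ring
  have e2 : |rker m l S * (4 * T * t2 T + 2 * N * t1 T)| ≤ K * (4 + 2 * N) * P * (δ * T⁻¹) := by
    rw [abs_mul, abs_of_pos kp]
    have e3 : |4 * T * t2 T + 2 * N * t1 T| ≤ (4 + 2 * N) * (δ * T⁻¹) := by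
      calc |4 * T * t2 T + 2 * N * t1 T| = |4 * (T * t2 T) + 2 * N * t1 T| := by ring_nf
        _ ≤ |4 * (T * t2 T)| + |2 * N * t1 T| := abs_add_le _ _
        _ = 4 * |T * t2 T| + 2 * N * |t1 T| := by
          rw [abs_mul, abs_mul (2 * (N : ℝ)), abs_of_pos (by norm_num : (0 : ℝ) < 4),
            abs_of_nonneg (by positivity : (0 : ℝ) ≤ 2 * N)]
        _ ≤ 4 * (δ * T⁻¹) + 2 * N * (δ * T⁻¹) := by gcongr
        _ = _ := by ring
    calc rker m l S * |4 * T * t2 T + 2 * N * t1 T| ≤ (K * P) * ((4 + 2 * N) * (δ * T⁻¹)) := by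
          gcongr
      _ = _ := by ring
  calc _ ≤ _ := abs_add_le _ _
    _ ≤ 8 * K * (1 + Xn) * P * (δ * T⁻¹) + K * (4 + 2 * N) * P * (δ * T⁻¹) := add_le_add e1 e2
    _ = (8 * K * (1 + Xn) + K * (4 + 2 * N)) * (δ * T⁻¹) * P := by ring
    _ ≤ (8 * K * (1 + Xn) + K * (4 + 2 * N)) * (δ * T⁻¹) *
        ((2 * (1 + Xn ^ 2)) ^ m * (1 + T) ^ (-m)) := by gcongr
    _ = _ := by rw [hδ]; ring

lemma hasCompactSupport_rkerLap {m l : ℝ} (hl : 0 < l) (x : Euc N) :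
    HasCompactSupport fun y : Euc N => rkerLap m l (‖y - x‖ ^ 2) := by
  refine HasCompactSupport.intro (isCompact_closedBall x (1 + l⁻¹)) fun y hy => ?_
  refine rkerLap_eq_zero ?_
  rw [mem_closedBall, dist_eq_norm, not_le] at hy
  have h1 : 0 < l⁻¹ := by positivity
  have h2 : l⁻¹ ≤ ‖y - x‖ ^ 2 := by nlinarith
  calc (1 : ℝ) = l * l⁻¹ := (mul_inv_cancel₀ hl.ne').symm
    _ ≤ _ := by gcongr

lemma integrable_rkerLap_mul {m l : ℝ} (hl : 0 < l) {w : Euc N → ℝ} (hw : Continuous w)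
    (x : Euc N) : Integrable fun y => rkerLap m l (‖y - x‖ ^ 2) * w y := by
  refine Continuous.integrable_of_hasCompactSupport ?_ ((hasCompactSupport_rkerLap hl x).mul_right)
  have : Continuous fun y : Euc N => rkerLap m l (‖y - x‖ ^ 2) :=
    continuous_rkerLap.comp (by fun_prop)
  exact this.mul hw

/-- Representation formula for nonnegative superharmonic functions with mild decay. -/
lemma integral_rker_mul_eq {m l : ℝ} (hm : 0 < m) (hN : (N : ℝ) = 2 * m + 2) (hl : 0 < l)
    {w g : Euc N → ℝ} (hw : ContDiffOn ℝ 2 w {x | x ≠ 0}) (hwc : Continuous w)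
    (hw0 : ∀ x, 0 ≤ w x) (hg : ∀ x, x ≠ 0 → -lap w x = g x) (hgc : ContinuousOn g {x | x ≠ 0})
    (hg0 : ∀ x, 0 ≤ g x)
    (hI : Integrable fun y => w y * ((‖y‖ ^ 2)⁻¹ * (1 + ‖y‖ ^ 2) ^ (-m))) (x : Euc N) :
    Integrable (fun y => rker m l (‖y - x‖ ^ 2) * g y) ∧
      ∫ y, rker m l (‖y - x‖ ^ 2) * g y = ∫ y, rkerLap m l (‖y - x‖ ^ 2) * w y := by
  have hNpos : 0 < N := by
    have : (0 : ℝ) < N := by rw [hN]; linarith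
    exact_mod_cast this
  obtain ⟨C, hC, hcut⟩ := exists_logCutoff
  choose t t1 t2 ht using hcut
  obtain ⟨D, hD, hE⟩ := abs_green_error_le (N := N) hm hl C hC x
  have kc : Continuous fun y : Euc N => rker m l (‖y - x‖ ^ 2) :=
    (continuous_rker hl).comp (by fun_prop)
  have k1c : Continuous fun y : Euc N => rker1 m l (‖y - x‖ ^ 2) :=
    (continuous_rker1 hl).comp (by fun_prop)
  have tcs : ∀ n, Continuous (t n) := fun n =>
    continuous_iff_continuousAt.2 fun s => ((ht n).deriv0 s).continuousAt
  have t1cs : ∀ n, Continuous (t1 n) := fun n =>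
    continuous_iff_continuousAt.2 fun s => ((ht n).deriv1 s).continuousAt
  have tc : ∀ n, Continuous fun y : Euc N => t n (‖y‖ ^ 2) := fun n =>
    (tcs n).comp (by fun_prop)
  have t1c : ∀ n, Continuous fun y : Euc N => t1 n (‖y‖ ^ 2) := fun n =>
    (t1cs n).comp (by fun_prop)
  have t2c : ∀ n, Continuous fun y : Euc N => t2 n (‖y‖ ^ 2) := fun n =>
    (ht n).cont.comp (by fun_prop)
  have hkg : ContinuousOn (fun y => rker m l (‖y - x‖ ^ 2) * g y) {x | x ≠ 0} :=
    kc.continuousOn.mul hgc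
  have hFi : ∀ n, Integrable fun y => rker m l (‖y - x‖ ^ 2) * g y * t n (‖y‖ ^ 2) := fun n => by
    obtain ⟨c, d, hc, -, hz⟩ := (ht n).supp
    refine integrable_of_annulus hc (d := d) (hkg.mul (tc n).continuousOn) fun y hy => ?_
    simp [(hz _ hy).1]
  have hGi := integrable_rkerLap_mul (m := m) hl hwc x
  have hGle : ∀ n y, ‖rkerLap m l (‖y - x‖ ^ 2) * w y * t n (‖y‖ ^ 2)‖ ≤
      rkerLap m l (‖y - x‖ ^ 2) * w y := fun n y => by
    have h0 : 0 ≤ rkerLap m l (‖y - x‖ ^ 2) * w y := mul_nonneg (rkerLap_nonneg hm hl _) (hw0 y)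
    rw [Real.norm_of_nonneg (mul_nonneg h0 ((ht n).nonneg _))]
    exact mul_le_of_le_one_right h0 ((ht n).le_one _)
  have hGni : ∀ n, Integrable fun y => rkerLap m l (‖y - x‖ ^ 2) * w y * t n (‖y‖ ^ 2) := fun n =>
    hGi.mono' (hGi.1.mul (tc n).aestronglyMeasurable) (Eventually.of_forall (hGle n))
  have hone : ∀ᵐ y : Euc N, Tendsto (fun n => t n (‖y‖ ^ 2)) atTop (𝓝 1) := by
    filter_upwards [ae_ne_zero hNpos] with y hy
    exact IsLogCutoff.tendsto_one ht (norm_sq_pos hy)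
  have hGlim : Tendsto (fun n => ∫ y, rkerLap m l (‖y - x‖ ^ 2) * w y * t n (‖y‖ ^ 2)) atTop
      (𝓝 (∫ y, rkerLap m l (‖y - x‖ ^ 2) * w y)) := by
    refine tendsto_integral_of_dominated_convergence _ (fun n => (hGni n).1) hGi
      (fun n => Eventually.of_forall (hGle n)) ?_
    filter_upwards [hone] with y hy
    simpa using hy.const_mul (rkerLap m l (‖y - x‖ ^ 2) * w y)
  let E : ℕ → Euc N → ℝ := fun n y =>
    8 * rker1 m l (‖y - x‖ ^ 2) * t1 n (‖y‖ ^ 2) * inner ℝ (y - x) y +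
        rker m l (‖y - x‖ ^ 2) * (4 * ‖y‖ ^ 2 * t2 n (‖y‖ ^ 2) + 2 * N * t1 n (‖y‖ ^ 2))
  have hEc : ∀ n, Continuous (E n) := fun n => by
    have h1 : Continuous fun y : Euc N => inner ℝ (y - x) y := by fun_prop
    have h2 : Continuous fun y : Euc N => 4 * ‖y‖ ^ 2 := by fun_prop
    exact (((continuous_const.mul k1c).mul (t1c n)).mul h1).add
      (kc.mul ((h2.mul (t2c n)).add (continuous_const.mul (t1c n))))
  have hEle : ∀ n, ∀ᵐ y : Euc N, ‖w y * E n y‖ ≤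
      D / (n + 1) * (w y * ((‖y‖ ^ 2)⁻¹ * (1 + ‖y‖ ^ 2) ^ (-m))) := fun n => by
    filter_upwards [ae_ne_zero hNpos] with y hy
    have := mul_le_mul_of_nonneg_left (hE n _ _ _ (ht n) y hy) (hw0 y)
    rw [Real.norm_eq_abs, abs_mul, abs_of_nonneg (hw0 y)]
    exact this.trans (le_of_eq (by ring))
  have hEi : ∀ n, Integrable fun y => w y * E n y := fun n =>
    (hI.const_mul _).mono' (hwc.mul (hEc n)).aestronglyMeasurable (hEle n)
  have hElim : Tendsto (fun n => ∫ y, w y * E n y) atTop (𝓝 0) := by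
    have hb : ∀ n : ℕ, ‖∫ y, w y * E n y‖ ≤
        D / (n + 1) * ∫ y, w y * ((‖y‖ ^ 2)⁻¹ * (1 + ‖y‖ ^ 2) ^ (-m)) := fun n => by
      rw [← integral_const_mul]
      exact norm_integral_le_of_norm_le (hI.const_mul _) (hEle n)
    refine squeeze_zero_norm hb ?_
    have h1 : Tendsto (fun n : ℕ => D / ((n : ℝ) + 1)) atTop (𝓝 0) := by
      have := (tendsto_one_div_add_atTop_nhds_zero_nat (𝕜 := ℝ)).const_mul D
      simpa [div_eq_mul_inv] using this
    simpa using h1.mul_const _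
  have hgreen : ∀ n, ∫ y, rker m l (‖y - x‖ ^ 2) * g y * t n (‖y‖ ^ 2) =
      (∫ y, rkerLap m l (‖y - x‖ ^ 2) * w y * t n (‖y‖ ^ 2)) - ∫ y, w y * E n y := fun n => by
    have h0 := green_annulus hw (hasDerivAt_rker (m := m) hl) (hasDerivAt_rker1 hl)
      continuous_rker2 (ht n) x
    have h1 : ∫ y, (rkerLap m l (‖y - x‖ ^ 2) * w y * t n (‖y‖ ^ 2) - w y * E n y -
        rker m l (‖y - x‖ ^ 2) * g y * t n (‖y‖ ^ 2)) = 0 := by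
      rw [← h0]
      refine integral_congr_ae ?_
      filter_upwards [ae_ne_zero hNpos] with y hy
      rw [← hg y hy, rkerLap_eq hl, ← hN]
      simp only [E]
      ring
    have h2 : Integrable fun y =>
        rkerLap m l (‖y - x‖ ^ 2) * w y * t n (‖y‖ ^ 2) - w y * E n y := (hGni n).sub (hEi n)
    rw [integral_sub h2 (hFi n), integral_sub (hGni n) (hEi n)] at h1
    linarith
  refine integrable_and_integral_eq_of_tendsto_cutoff (τ := fun n y => t n (‖y‖ ^ 2))
    (aestronglyMeasurable_of_continuousOn hNpos hkg)
    (fun y => mul_nonneg (rker_pos hm hl _).le (hg0 y)) hFi (fun n y => (ht n).nonneg _)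
    (fun n y => (ht n).le_one _) hone ?_
  simp only [hgreen]
  simpa using hGlim.sub hElim

end Representation

section Integrability

open scoped Pointwise

variable {N : ℕ}

lemma integrableOn_norm_rpow (hN : 0 < N) {s : ℝ} (hs : -(N : ℝ) < s) {r : ℝ} (hr : 0 < r) :
    IntegrableOn (fun x : Euc N => ‖x‖ ^ s) (ball 0 r) := by
  have : NeZero N := ⟨hN.ne'⟩
  have : Nontrivial (Euc N) := by
    refine ⟨EuclideanSpace.single 0 1, 0, fun h => ?_⟩
    simpa using congrArg norm h
  rw [integrableOn_fun_norm_addHaar (volume : Measure (Euc N)) (f := fun y => y ^ s)]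
  have h := (intervalIntegral.integrableOn_Ioo_rpow_iff hr (s := (N : ℝ) - 1 + s)).2 (by linarith)
  refine h.congr_fun (fun y hy => ?_) measurableSet_Ioo
  have hc : ((N - 1 : ℕ) : ℝ) = (N : ℝ) - 1 := by
    rw [Nat.cast_sub hN]; simp
  simp only [finrank_euclideanSpace_fin, smul_eq_mul]
  rw [Real.rpow_add hy.1, ← hc, Real.rpow_natCast]

lemma integrableOn_norm_rpow_mul (hN : 0 < N) {s : ℝ} (hs : -(N : ℝ) < s) {r : ℝ} (hr : 0 < r)
    {φ : Euc N → ℝ} (hφ : Continuous φ) :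
    IntegrableOn (fun x : Euc N => ‖x‖ ^ s * φ x) (ball 0 r) :=
  (integrableOn_norm_rpow hN hs hr).mul_continuousOn_of_subset hφ.continuousOn measurableSet_ball
    (isCompact_closedBall 0 r) ball_subset_closedBall

lemma rpow_le_add_rpow {c d t : ℝ} (hc : 0 < c) (hct : c ≤ t) (htd : t ≤ d) (e : ℝ) :
    t ^ e ≤ c ^ e + d ^ e := by
  have ht := hc.trans_le hct
  rcases le_total 0 e with he | he
  · have := Real.rpow_le_rpow ht.le htd he
    have : 0 ≤ c ^ e := by positivity
    linarith
  · have := Real.rpow_le_rpow_of_nonpos hc hct he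
    have : 0 ≤ d ^ e := Real.rpow_nonneg (ht.le.trans htd) _
    linarith

/-- A uniform bound on the rescaled energy in an annulus gives finite weighted energy. -/
lemma integrable_of_rescaled_bound (hN : 0 < N) {w : Euc N → ℝ} (hw : Continuous w)
    (hw0 : ∀ x, 0 ≤ w x) {r A e R₁ R₄ C₀ Rs : ℝ} (hr : 0 < r) (he : -(N : ℝ) < e)
    (hγ : (N : ℝ) + e < A * r) (hR₁ : 0 < R₁) (hR : R₁ < R₄) (hRs : 0 < Rs)
    (h : ∀ R, Rs ≤ R → ∫ x in ball (0 : Euc N) R₄ \ ball 0 R₁, (R ^ A * w (R • x)) ^ r ≤ C₀) :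
    Integrable fun x => ‖x‖ ^ e * w x ^ r := by
  have hR₄ := hR₁.trans hR
  have hwr : Continuous fun x => w x ^ r := hw.rpow_const fun x => Or.inr hr.le
  set θ := R₄ / R₁ with hθ
  have hθ1 : 1 < θ := (one_lt_div hR₁).2 hR
  set ρ : ℕ → ℝ := fun k => Rs * θ ^ k with hρ
  have hρ0 : ∀ k, 0 < ρ k := fun k => by positivity
  have hρs : ∀ k, Rs ≤ ρ k := fun k => le_mul_of_one_le_right hRs.le (one_le_pow₀ hθ1.le)
  set D : Set (Euc N) := ball 0 R₄ \ ball 0 R₁ with hD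
  have hDm : MeasurableSet D := measurableSet_ball.diff measurableSet_ball
  have hmem : ∀ k y, y ∈ ρ k • D ↔ ρ k * R₁ ≤ ‖y‖ ∧ ‖y‖ < ρ k * R₄ := fun k y => by
    rw [mem_smul_set_iff_inv_smul_mem₀ (hρ0 k).ne', hD, Set.mem_sdiff, mem_ball_zero_iff,
      mem_ball_zero_iff, norm_smul, norm_inv, Real.norm_of_nonneg (hρ0 k).le, not_lt,
      inv_mul_lt_iff₀ (hρ0 k), le_inv_mul_iff₀ (hρ0 k), and_comm]
  have hInt : ∀ k, IntegrableOn (fun x => ‖x‖ ^ e * w x ^ r) (ρ k • D) := fun k =>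
    (integrableOn_norm_rpow_mul hN he (mul_pos (hρ0 k) hR₄) hwr).mono_set fun y hy => by
      rw [mem_ball_zero_iff]; exact ((hmem k y).1 hy).2
  have hC : ∀ k, ∫ x in ρ k • D, ‖‖x‖ ^ e * w x ^ r‖ ≤
      ρ k ^ ((N : ℝ) + e - A * r) * ((R₁ ^ e + R₄ ^ e) * C₀) := fun k => by
    have hk := hρ0 k
    have e0 : ∫ x in ρ k • D, ‖‖x‖ ^ e * w x ^ r‖ = ∫ x in ρ k • D, ‖x‖ ^ e * w x ^ r := by
      congr 1
      ext x
      exact Real.norm_of_nonneg (mul_nonneg (Real.rpow_nonneg (norm_nonneg x) _)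
        (Real.rpow_nonneg (hw0 x) _))
    have e1 : ∫ x in ρ k • D, ‖x‖ ^ e * w x ^ r =
        ρ k ^ N * ∫ x in D, ‖ρ k • x‖ ^ e * w (ρ k • x) ^ r := by
      have := Measure.setIntegral_comp_smul_of_pos (volume : Measure (Euc N))
        (fun x => ‖x‖ ^ e * w x ^ r) D hk
      rw [this, finrank_euclideanSpace_fin, smul_eq_mul, ← mul_assoc,
        mul_inv_cancel₀ (by positivity), one_mul]
    have hDs : D ⊆ closedBall 0 R₄ := sdiff_subset.trans ball_subset_closedBall
    have i0 : IntegrableOn (fun x => (ρ k ^ A * w (ρ k • x)) ^ r) D := by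
      refine IntegrableOn.mono_set
        (ContinuousOn.integrableOn_compact (isCompact_closedBall (0 : Euc N) R₄) ?_) hDs
      refine (Continuous.rpow_const ?_ fun x => Or.inr hr.le).continuousOn
      exact continuous_const.mul (hw.comp (continuous_const_smul _))
    have e2 : ∫ x in D, ‖ρ k • x‖ ^ e * w (ρ k • x) ^ r ≤
        ∫ x in D, (ρ k ^ (e - A * r) * (R₁ ^ e + R₄ ^ e)) * (ρ k ^ A * w (ρ k • x)) ^ r := by
      refine integral_mono_of_nonneg (Eventually.of_forall fun x => ?_) (i0.const_mul _) ?_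
      · exact mul_nonneg (Real.rpow_nonneg (norm_nonneg _) _) (Real.rpow_nonneg (hw0 _) _)
      · filter_upwards [ae_restrict_mem hDm] with x hx
        rw [hD, Set.mem_sdiff, mem_ball_zero_iff, mem_ball_zero_iff, not_lt] at hx
        rw [norm_smul, Real.norm_of_nonneg hk.le, Real.mul_rpow hk.le (norm_nonneg x),
          Real.mul_rpow (by positivity) (hw0 _), ← Real.rpow_mul hk.le, Real.rpow_sub hk]
        have h1 := rpow_le_add_rpow hR₁ hx.2 hx.1.le e
        have h2 : 0 ≤ w (ρ k • x) ^ r := Real.rpow_nonneg (hw0 _) _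
        have h3 : 0 < ρ k ^ (A * r) := by positivity
        calc ρ k ^ e * ‖x‖ ^ e * w (ρ k • x) ^ r
            ≤ ρ k ^ e * (R₁ ^ e + R₄ ^ e) * w (ρ k • x) ^ r := by gcongr
          _ = _ := by field_simp
    rw [e0, e1]
    calc ρ k ^ N * ∫ x in D, ‖ρ k • x‖ ^ e * w (ρ k • x) ^ r
        ≤ ρ k ^ N * ((ρ k ^ (e - A * r) * (R₁ ^ e + R₄ ^ e)) * C₀) := by
          refine mul_le_mul_of_nonneg_left (e2.trans ?_) (by positivity)
          rw [integral_const_mul]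
          exact mul_le_mul_of_nonneg_left (h _ (hρs k)) (by positivity)
      _ = _ := by
        rw [add_sub_assoc, Real.rpow_add hk, Real.rpow_natCast]; ring
  have hsum : Summable fun k => ρ k ^ ((N : ℝ) + e - A * r) * ((R₁ ^ e + R₄ ^ e) * C₀) := by
    have e1 : ∀ k, ρ k ^ ((N : ℝ) + e - A * r) =
        Rs ^ ((N : ℝ) + e - A * r) * (θ ^ ((N : ℝ) + e - A * r)) ^ k := fun k => by
      rw [hρ]
      simp only
      rw [Real.mul_rpow hRs.le (by positivity), ← Real.rpow_natCast, ← Real.rpow_natCast,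
        ← Real.rpow_mul (by positivity), ← Real.rpow_mul (by positivity), mul_comm (k : ℝ)]
    simp only [e1]
    refine ((summable_geometric_of_lt_one (by positivity) ?_).mul_left _).mul_right _
    exact Real.rpow_lt_one_of_one_lt_of_neg hθ1 (by linarith)
  have hU := integrableOn_iUnion_of_summable_integral_norm hInt
    (hsum.of_nonneg_of_le (fun k => integral_nonneg fun x => norm_nonneg _) hC)
  have hB := integrableOn_norm_rpow_mul hN he (mul_pos hRs hR₁) hwr
  rw [← integrableOn_univ]
  refine (hB.union hU).mono_set fun y _ => ?_
  by_cases hy : ‖y‖ < Rs * R₁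
  · left; simpa using hy
  · right
    rw [not_lt] at hy
    obtain ⟨k, hk1, hk2⟩ := exists_nat_pow_near
      ((one_le_div (by positivity)).2 hy : 1 ≤ ‖y‖ / (Rs * R₁)) hθ1
    rw [mem_iUnion]
    refine ⟨k, (hmem k y).2 ⟨?_, ?_⟩⟩
    · rw [le_div_iff₀ (by positivity)] at hk1
      simp only [hρ]; linarith
    · rw [div_lt_iff₀ (by positivity), pow_succ] at hk2
      have : θ ^ k * θ * (Rs * R₁) = ρ k * R₄ := by
        have : θ * R₁ = R₄ := div_mul_cancel₀ _ hR₁.ne'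
        rw [← this]; ring
      linarith

lemma integrable_mul_decay (hN : 2 < N) {w : Euc N → ℝ} (hw : Continuous w)
    (hw0 : ∀ x, 0 ≤ w x) {p a m : ℝ} (hp : 0 < p) (ha : -2 < a) (hm : (N : ℝ) = 2 * m + 2)
    (h : Integrable fun x => ‖x‖ ^ a * w x ^ (p + 1)) :
    Integrable fun y => w y * ((‖y‖ ^ 2)⁻¹ * (1 + ‖y‖ ^ 2) ^ (-m)) := by
  have hN2 : (2 : ℝ) < N := by exact_mod_cast hN
  have hm0 : 0 < m := by linarith
  have hNpos : 0 < N := by omega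
  set ε := ((N : ℝ) + a) / p with hε
  have hε0 : 0 < ε := div_pos (by linarith) hp
  have hmeas : AEStronglyMeasurable
      (fun y : Euc N => w y * ((‖y‖ ^ 2)⁻¹ * (1 + ‖y‖ ^ 2) ^ (-m))) volume := by
    refine (hw.measurable.mul ?_).aestronglyMeasurable
    fun_prop
  have hc : Continuous fun y : Euc N => w y * (1 + ‖y‖ ^ 2) ^ (-m) := by
    refine hw.mul (Continuous.rpow_const (by fun_prop) fun x => Or.inl ?_)
    positivity
  have hin : IntegrableOn (fun y : Euc N => w y * ((‖y‖ ^ 2)⁻¹ * (1 + ‖y‖ ^ 2) ^ (-m)))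
      (ball 0 1) := by
    refine (integrableOn_norm_rpow_mul hNpos (s := -2) (by linarith) one_pos hc).congr_fun
      (fun y _ => ?_) measurableSet_ball
    simp only
    rw [Real.rpow_neg (norm_nonneg y), Real.rpow_two]
    ring
  have hout : IntegrableOn (fun y : Euc N => w y * ((‖y‖ ^ 2)⁻¹ * (1 + ‖y‖ ^ 2) ^ (-m)))
      (ball 0 1)ᶜ := by
    have hJ : Integrable fun y : Euc N => (1 + ‖y‖) ^ (-((N : ℝ) + ε)) :=
      integrable_one_add_norm (by rw [finrank_euclideanSpace_fin]; linarith)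
    refine Integrable.mono' ((h.add (hJ.const_mul (2 ^ ((N : ℝ) + ε)))).integrableOn)
      hmeas.restrict ?_
    filter_upwards [ae_restrict_mem measurableSet_ball.compl] with y hy
    rw [mem_compl_iff, mem_ball_zero_iff, not_lt] at hy
    have hy0 : 0 < ‖y‖ := by linarith
    rw [Real.norm_of_nonneg (mul_nonneg (hw0 y) (by positivity))]
    have h1 : (‖y‖ ^ 2)⁻¹ * (1 + ‖y‖ ^ 2) ^ (-m) ≤ ‖y‖ ^ (-(N : ℝ)) := by
      have h2 : (1 + ‖y‖ ^ 2) ^ (-m) ≤ (‖y‖ ^ 2) ^ (-m) :=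
        Real.rpow_le_rpow_of_nonpos (by positivity) (by linarith) (by linarith)
      calc (‖y‖ ^ 2)⁻¹ * (1 + ‖y‖ ^ 2) ^ (-m) ≤ (‖y‖ ^ 2)⁻¹ * (‖y‖ ^ 2) ^ (-m) := by gcongr
        _ = ‖y‖ ^ (-(N : ℝ)) := by
          rw [← Real.rpow_two, ← Real.rpow_neg hy0.le, ← Real.rpow_mul hy0.le,
            ← Real.rpow_add hy0, hm]
          congr 1; ring
    refine (mul_le_mul_of_nonneg_left h1 (hw0 y)).trans ?_
    simp only [Pi.add_apply]
    rcases le_total (‖y‖ ^ (-ε)) (w y) with hle | hle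
    · have h2 : w y * ‖y‖ ^ (-(N : ℝ)) ≤ ‖y‖ ^ a * w y ^ (p + 1) := by
        have hwp : 0 < w y := lt_of_lt_of_le (by positivity) hle
        have h3 : ‖y‖ ^ (-((N : ℝ) + a)) ≤ w y ^ p := by
          have := Real.rpow_le_rpow (by positivity) hle hp.le
          rwa [← Real.rpow_mul hy0.le, hε, neg_mul, div_mul_cancel₀ _ hp.ne'] at this
        calc w y * ‖y‖ ^ (-(N : ℝ)) = ‖y‖ ^ a * (‖y‖ ^ (-((N : ℝ) + a)) * w y) := by
              rw [← mul_assoc, ← Real.rpow_add hy0, mul_comm]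
              congr 2; ring
          _ ≤ ‖y‖ ^ a * (w y ^ p * w y) := by gcongr
          _ = _ := by rw [Real.rpow_add_one hwp.ne']
      have : 0 ≤ 2 ^ ((N : ℝ) + ε) * (1 + ‖y‖) ^ (-((N : ℝ) + ε)) := by positivity
      linarith
    · have h2 : w y * ‖y‖ ^ (-(N : ℝ)) ≤ 2 ^ ((N : ℝ) + ε) * (1 + ‖y‖) ^ (-((N : ℝ) + ε)) := by
        calc w y * ‖y‖ ^ (-(N : ℝ)) ≤ ‖y‖ ^ (-ε) * ‖y‖ ^ (-(N : ℝ)) := by gcongr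
          _ = ‖y‖ ^ (-((N : ℝ) + ε)) := by
            rw [← Real.rpow_add hy0]; congr 1; ring
          _ ≤ ((1 + ‖y‖) / 2) ^ (-((N : ℝ) + ε)) :=
            Real.rpow_le_rpow_of_nonpos (by positivity) (by linarith) (by linarith)
          _ = _ := by
            rw [Real.div_rpow (by positivity) (by norm_num), Real.rpow_neg (by norm_num : (0:ℝ) ≤ 2)]
            field_simp
      have : 0 ≤ ‖y‖ ^ a * w y ^ (p + 1) :=
        mul_nonneg (by positivity) (Real.rpow_nonneg (hw0 y) _)
      linarith
  have := hin.union hout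
  rwa [union_compl_self, integrableOn_univ] at this

end Integrability

section Mollification

variable {N : ℕ} {m l : ℝ}

/-- Convolution of `w` with the mollifier `rkerLap m l (‖·‖ ^ 2)`. -/
def mollify (m l : ℝ) (w : Euc N → ℝ) (x : Euc N) : ℝ :=
  ∫ y, rkerLap m l (‖y - x‖ ^ 2) * w y

/-- Total mass of the mollifiers `rkerLap m l (‖·‖ ^ 2)` in dimension `N = 2 * m + 2`. -/
def kerMass (N : ℕ) (m : ℝ) : ℝ := ∫ z : Euc N, rkerLap m 1 (‖z‖ ^ 2)

lemma mollify_eq (w : Euc N → ℝ) (x : Euc N) :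
    mollify m l w x = ∫ z, rkerLap m l (‖z‖ ^ 2) * w (x + z) := by
  have := integral_add_right_eq_self (μ := (volume : Measure (Euc N)))
    (fun y => rkerLap m l (‖y - x‖ ^ 2) * w y) x
  simp only [add_sub_cancel_right] at this
  rw [mollify, ← this]
  simp only [add_comm]

lemma kerMass_pos (hm : 0 < m) : 0 < kerMass N m := by
  have hc : Continuous fun z : Euc N => rkerLap m 1 (‖z‖ ^ 2) :=
    continuous_rkerLap.comp (by fun_prop)
  have hs := hasCompactSupport_rkerLap (m := m) one_pos (0 : Euc N)
  simp only [sub_zero] at hs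
  refine hc.integral_pos_of_hasCompactSupport_nonneg_nonzero hs
    (fun z => rkerLap_nonneg hm one_pos _) (x := 0) ?_
  simp only [rkerLap, profLap, norm_zero]
  norm_num
  refine ⟨⟨hm.ne', ?_⟩, ?_⟩ <;> linarith

lemma integral_rkerLap (hN : (N : ℝ) = 2 * m + 2) (hl : 0 < l) :
    ∫ z : Euc N, rkerLap m l (‖z‖ ^ 2) = kerMass N m := by
  have h := Measure.integral_comp_smul_of_nonneg (volume : Measure (Euc N))
    (fun z => rkerLap m 1 (‖z‖ ^ 2)) (√l) (hR := Real.sqrt_nonneg l)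
  have e : ∀ z : Euc N, rkerLap m l (‖z‖ ^ 2) = l ^ (m + 1) * rkerLap m 1 (‖√l • z‖ ^ 2) := by
    intro z
    rw [norm_smul, mul_pow, Real.norm_of_nonneg (Real.sqrt_nonneg l), Real.sq_sqrt hl.le]
    simp [rkerLap]
  have hpow : √l ^ N = l ^ (m + 1) := by
    rw [← Real.rpow_natCast, Real.sqrt_eq_rpow, ← Real.rpow_mul hl.le, hN]
    congr 1; ring
  have hpos : 0 < l ^ (m + 1) := by positivity
  simp only [e]
  rw [integral_const_mul, h, finrank_euclideanSpace_fin, smul_eq_mul, hpow, ← mul_assoc,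
    mul_inv_cancel₀ hpos.ne', one_mul, kerMass]

lemma integrable_rkerLap_mul' (hl : 0 < l) {φ : Euc N → ℝ} (hφ : Continuous φ) :
    Integrable fun z => rkerLap m l (‖z‖ ^ 2) * φ z := by
  simpa using integrable_rkerLap_mul (m := m) hl hφ 0

lemma abs_integral_rkerLap_mul_sub_le (hm : 0 < m) (hN : (N : ℝ) = 2 * m + 2) (hl : 0 < l)
    {φ : Euc N → ℝ} (hφ : Continuous φ) {c ε : ℝ} (h : ∀ z, l * ‖z‖ ^ 2 < 1 → |φ z - c| ≤ ε) :
    |(∫ z, rkerLap m l (‖z‖ ^ 2) * φ z) - kerMass N m * c| ≤ kerMass N m * ε := by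
  have hi : ∀ e : ℝ, Integrable fun z : Euc N => rkerLap m l (‖z‖ ^ 2) * e := fun e =>
    integrable_rkerLap_mul' hl continuous_const
  rw [← integral_rkerLap hN hl, ← integral_mul_const, ← integral_mul_const,
    ← integral_sub (integrable_rkerLap_mul' hl hφ) (hi c), ← Real.norm_eq_abs]
  refine norm_integral_le_of_norm_le (hi ε) (Eventually.of_forall fun z => ?_)
  rw [← mul_sub, norm_mul, Real.norm_of_nonneg (rkerLap_nonneg hm hl _), Real.norm_eq_abs]
  rcases lt_or_ge (l * ‖z‖ ^ 2) 1 with hz | hz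
  · exact mul_le_mul_of_nonneg_left (h z hz) (rkerLap_nonneg hm hl _)
  · rw [rkerLap_eq_zero hz]; simp

lemma norm_lt_of_mul_sq_lt (hl : 0 < l) {δ : ℝ} (hδ : 0 < δ) (h : δ⁻¹ ^ 2 ≤ l) {z : Euc N}
    (hz : l * ‖z‖ ^ 2 < 1) : ‖z‖ < δ := by
  by_contra hcon
  rw [not_lt] at hcon
  have : (1 : ℝ) ≤ l * ‖z‖ ^ 2 := by
    calc (1 : ℝ) = δ⁻¹ ^ 2 * δ ^ 2 := by field_simp
      _ ≤ l * ‖z‖ ^ 2 := by gcongr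
  linarith

lemma mollify_nonneg (hm : 0 < m) (hl : 0 < l) {w : Euc N → ℝ} (hw0 : ∀ x, 0 ≤ w x) (x : Euc N) :
    0 ≤ mollify m l w x :=
  integral_nonneg fun y => mul_nonneg (rkerLap_nonneg hm hl _) (hw0 y)

lemma tendsto_mollify (hm : 0 < m) (hN : (N : ℝ) = 2 * m + 2) {w : Euc N → ℝ} (hw : Continuous w)
    (x : Euc N) :
    Tendsto (fun l => mollify m l w x) atTop (𝓝 (kerMass N m * w x)) := by
  have hκ := kerMass_pos (N := N) hm
  rw [Metric.tendsto_nhds]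
  intro ε hε
  have hε' : 0 < ε / (2 * kerMass N m) := by positivity
  obtain ⟨δ, hδ, hδ'⟩ := (Metric.continuousAt_iff (a := x)).1 hw.continuousAt _ hε'
  filter_upwards [eventually_ge_atTop (δ⁻¹ ^ 2), eventually_gt_atTop 0] with l hl hl0
  rw [mollify_eq, Real.dist_eq]
  refine (abs_integral_rkerLap_mul_sub_le hm hN hl0 (φ := fun z => w (x + z)) (by fun_prop)
    (ε := ε / (2 * kerMass N m)) fun z hz => ?_).trans_lt ?_
  · have := hδ' (x := x + z) (by simpa using norm_lt_of_mul_sq_lt hl0 hδ hl hz)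
    exact this.le
  · field_simp
    norm_num

/-- A nonnegative function `w`, superharmonic off the origin with `-Δ w = g`, with an integrability
condition that excludes additive constants. -/
structure IsDecayingSuper (m : ℝ) (w g : Euc N → ℝ) : Prop where
  smooth : ContDiffOn ℝ 2 w {x | x ≠ 0}
  cont : Continuous w
  nonneg : ∀ x, 0 ≤ w x
  eqn : ∀ x, x ≠ 0 → -lap w x = g x
  rhs_cont : ContinuousOn g {x | x ≠ 0}
  rhs_nonneg : ∀ x, 0 ≤ g x
  decay : Integrable fun y => w y * ((‖y‖ ^ 2)⁻¹ * (1 + ‖y‖ ^ 2) ^ (-m))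

namespace IsDecayingSuper

variable {w g : Euc N → ℝ}

lemma integrable_rker_mul (h : IsDecayingSuper m w g) (hm : 0 < m) (hN : (N : ℝ) = 2 * m + 2)
    (hl : 0 < l) (x : Euc N) : Integrable fun y => rker m l (‖y - x‖ ^ 2) * g y :=
  (integral_rker_mul_eq hm hN hl h.smooth h.cont h.nonneg h.eqn h.rhs_cont h.rhs_nonneg h.decay x).1

lemma integral_rker_mul (h : IsDecayingSuper m w g) (hm : 0 < m) (hN : (N : ℝ) = 2 * m + 2)
    (hl : 0 < l) (x : Euc N) : ∫ y, rker m l (‖y - x‖ ^ 2) * g y = mollify m l w x :=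
  (integral_rker_mul_eq hm hN hl h.smooth h.cont h.nonneg h.eqn h.rhs_cont h.rhs_nonneg h.decay x).2

lemma mollify_le (h : IsDecayingSuper m w g) (hm : 0 < m) (hN : (N : ℝ) = 2 * m + 2)
    (hl : 0 < l) (x : Euc N) : mollify m l w x ≤ kerMass N m * w x := by
  refine ge_of_tendsto (tendsto_mollify hm hN h.cont x) ?_
  filter_upwards [eventually_ge_atTop l] with k hk
  rw [← h.integral_rker_mul hm hN hl, ← h.integral_rker_mul hm hN (hl.trans_le hk)]
  refine integral_mono (h.integrable_rker_mul hm hN hl x)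
    (h.integrable_rker_mul hm hN (hl.trans_le hk) x) fun y => ?_
  exact mul_le_mul_of_nonneg_right (rker_mono hm hl hk (by positivity)) (h.rhs_nonneg y)

end IsDecayingSuper

lemma stronglyMeasurable_mollify {w : Euc N → ℝ} (hw : Continuous w) :
    StronglyMeasurable (mollify m l w) := by
  have hc : Continuous fun q : Euc N × Euc N => rkerLap m l (‖q.2 - q.1‖ ^ 2) * w q.2 :=
    (continuous_rkerLap.comp (by fun_prop)).mul (hw.comp continuous_snd)
  exact hc.stronglyMeasurable.integral_prod_right (ν := (volume : Measure (Euc N)))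

lemma exists_ball_taylor {w : Euc N → ℝ} (hw : ContDiffOn ℝ 2 w {x | x ≠ 0}) {c d : ℝ}
    (hc : 0 < c) {ε : ℝ} (hε : 0 < ε) :
    ∃ δ, 0 < δ ∧ ∀ x : Euc N, ‖x‖ ^ 2 ∈ Icc c d → ∀ y ∈ ball x δ, ∀ z ∈ ball x δ,
      ‖w z - w y - fderiv ℝ w x (z - y)‖ ≤ ε * ‖z - y‖ := by
  have hc4 : 0 < c / 4 := by positivity
  have hK := isCompact_annulus (N := N) (c / 4) (2 * d + c / 2)
  have hKs := annulus_subset (N := N) (d := 2 * d + c / 2) hc4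
  have hf : ContinuousOn (fderiv ℝ w) {x | x ≠ 0} :=
    (hw.fderiv_of_isOpen (m := 1) isOpen_ne_zero (by norm_num)).continuousOn
  obtain ⟨δ, hδ, hδ'⟩ := Metric.uniformContinuousOn_iff.1
    (hK.uniformContinuousOn_of_continuous (hf.mono hKs)) ε hε
  have hsc : 0 < √c := Real.sqrt_pos.2 hc
  have hsc2 : √c ^ 2 = c := Real.sq_sqrt hc.le
  refine ⟨min δ (√c / 2), lt_min hδ (by positivity), fun x hx => ?_⟩
  have hsub : ball x (min δ (√c / 2)) ⊆ {y : Euc N | ‖y‖ ^ 2 ∈ Icc (c / 4) (2 * d + c / 2)} := by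
    intro y hy
    have h1 : ‖y - x‖ < √c / 2 := by
      rw [← dist_eq_norm]; exact (mem_ball.1 hy).trans_le (min_le_right _ _)
    have h2 : ‖x‖ ≤ ‖y‖ + ‖y - x‖ := by
      simpa [norm_sub_rev] using norm_add_le y (x - y)
    have h3 : ‖y‖ ≤ ‖x‖ + ‖y - x‖ := by
      simpa using norm_add_le x (y - x)
    have h4 : √c ≤ ‖x‖ := Real.sqrt_le_iff.2 ⟨norm_nonneg x, hx.1⟩
    have h5 := hx.2
    have h6 := norm_nonneg y
    constructor
    · have : √c / 2 ≤ ‖y‖ := by linarith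
      nlinarith
    · have : ‖y‖ ≤ ‖x‖ + √c / 2 := by linarith
      nlinarith [sq_nonneg (‖x‖ - √c / 2)]
  intro y hy z hz
  have hxm : x ∈ ball x (min δ (√c / 2)) := mem_ball_self (lt_min hδ (by positivity))
  refine (convex_ball x (min δ (√c / 2))).norm_image_sub_le_of_norm_fderiv_le' (fun a ha => ?_)
    (fun a ha => ?_) hy hz
  · exact (hw.differentiableOn (by norm_num)).differentiableAt
      (isOpen_ne_zero.mem_nhds (hKs (hsub ha)))
  · rw [← dist_eq_norm]
    exact (hδ' a (hsub ha) x (hsub hxm) ((mem_ball.1 ha).trans_le (min_le_left _ _))).le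

/-- First-order expansion of the mollification along a vector field supported in an annulus. -/
lemma eventually_abs_mollify_sub_le (hm : 0 < m) (hN : (N : ℝ) = 2 * m + 2) {w : Euc N → ℝ}
    (hw : ContDiffOn ℝ 2 w {x | x ≠ 0}) (hwc : Continuous w) {F : Euc N → Euc N} {M c d : ℝ}
    (hc : 0 < c) (hM : 0 ≤ M) (hF0 : ∀ x, ‖x‖ ^ 2 ∉ Icc c d → F x = 0) (hFM : ∀ x, ‖F x‖ ≤ M)
    {ε : ℝ} (hε : 0 < ε) :
    ∀ᶠ l in atTop, ∀ x, |mollify m l w (x + (l ^ 2)⁻¹ • F x) - mollify m l w x -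
      (l ^ 2)⁻¹ * kerMass N m * fderiv ℝ w x (F x)| ≤ (l ^ 2)⁻¹ * kerMass N m * ε := by
  have hκ := kerMass_pos (N := N) hm
  obtain ⟨δ, hδ, hT⟩ := exists_ball_taylor hw (d := d) hc
    (div_pos hε (by positivity : 0 < M + 1))
  have hlim : Tendsto (fun l : ℝ => (l ^ 2)⁻¹ * M) atTop (𝓝 0) := by
    have := (tendsto_pow_atTop (α := ℝ) two_ne_zero).inv_tendsto_atTop.mul_const M
    simpa using this
  filter_upwards [eventually_gt_atTop 0, eventually_ge_atTop ((δ / 2)⁻¹ ^ 2),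
    hlim.eventually_lt_const (half_pos hδ)] with l hl hl1 hl2 x
  by_cases hx : ‖x‖ ^ 2 ∈ Icc c d
  swap
  · rw [hF0 x hx]; simp; positivity
  have hp : 0 < (l ^ 2)⁻¹ := by positivity
  set h := (l ^ 2)⁻¹ • F x with hh
  have hhn : ‖h‖ = (l ^ 2)⁻¹ * ‖F x‖ := by
    rw [hh, norm_smul, Real.norm_of_nonneg hp.le]
  have hhlt : ‖h‖ < δ / 2 := by
    rw [hhn]
    exact (mul_le_mul_of_nonneg_left (hFM x) hp.le).trans_lt hl2
  have e1 : mollify m l w (x + h) - mollify m l w x =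
      ∫ z, rkerLap m l (‖z‖ ^ 2) * (w (x + h + z) - w (x + z)) := by
    rw [mollify_eq, mollify_eq, ← integral_sub
      (integrable_rkerLap_mul' hl (φ := fun z => w (x + h + z)) (by fun_prop))
      (integrable_rkerLap_mul' hl (φ := fun z => w (x + z)) (by fun_prop))]
    simp only [mul_sub]
  have e2 : (l ^ 2)⁻¹ * kerMass N m * fderiv ℝ w x (F x) =
      kerMass N m * fderiv ℝ w x h := by
    rw [hh, map_smul, smul_eq_mul]; ring
  rw [e1, e2, mul_comm (l ^ 2)⁻¹, mul_assoc]
  refine abs_integral_rkerLap_mul_sub_le hm hN hl (by fun_prop) fun z hz => ?_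
  have hz' := norm_lt_of_mul_sq_lt hl (half_pos hδ) hl1 hz
  have h1 := hT x hx (x + z) (by rw [mem_ball, dist_self_add_left]; linarith) (x + h + z) (by
    rw [add_assoc, mem_ball, dist_self_add_left]
    exact (norm_add_le h z).trans_lt (by linarith))
  have e3 : x + h + z - (x + z) = h := by abel
  rw [e3, Real.norm_eq_abs] at h1
  refine h1.trans ?_
  rw [hhn]
  calc ε / (M + 1) * ((l ^ 2)⁻¹ * ‖F x‖) ≤ ε / (M + 1) * ((l ^ 2)⁻¹ * (M + 1)) := by
        have := hFM x
        gcongr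
        linarith
    _ = (l ^ 2)⁻¹ * ε := by field_simp

end Mollification

section PairInequality

variable {N : ℕ} {m l : ℝ} {u v f g w : Euc N → ℝ}

lemma integrable_prod_rker (hm : 0 < m) (hN : (N : ℝ) = 2 * m + 2) (hl : 0 < l) (hN0 : 0 < N)
    (h : IsDecayingSuper m w g) {φ : Euc N → ℝ} (hφ : AEStronglyMeasurable φ volume)
    (φ0 : ∀ x, 0 ≤ φ x) {T : Euc N → Euc N} (hT : Continuous T)
    (hi : Integrable fun x => φ x * mollify m l w (T x)) :
    Integrable (fun q : Euc N × Euc N => φ q.1 * (rker m l (‖q.2 - T q.1‖ ^ 2) * g q.2))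
        (volume.prod volume) ∧
      ∫ q : Euc N × Euc N, φ q.1 * (rker m l (‖q.2 - T q.1‖ ^ 2) * g q.2) ∂(volume.prod volume) =
        ∫ x, φ x * mollify m l w (T x) := by
  have hk : Continuous fun q : Euc N × Euc N => rker m l (‖q.2 - T q.1‖ ^ 2) :=
    (continuous_rker hl).comp (by fun_prop)
  have hg := aestronglyMeasurable_of_continuousOn hN0 h.rhs_cont
  have hmeas : AEStronglyMeasurable
      (fun q : Euc N × Euc N => φ q.1 * (rker m l (‖q.2 - T q.1‖ ^ 2) * g q.2))
      (volume.prod volume) :=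
    hφ.comp_fst.mul (hk.aestronglyMeasurable.mul hg.comp_snd)
  have hin : ∀ x, ∫ y, φ x * (rker m l (‖y - T x‖ ^ 2) * g y) = φ x * mollify m l w (T x) :=
    fun x => by rw [integral_const_mul, h.integral_rker_mul hm hN hl]
  have hInt : Integrable (fun q : Euc N × Euc N =>
      φ q.1 * (rker m l (‖q.2 - T q.1‖ ^ 2) * g q.2)) (volume.prod volume) := by
    rw [integrable_prod_iff hmeas]
    refine ⟨Eventually.of_forall fun x => (h.integrable_rker_mul hm hN hl (T x)).const_mul (φ x), ?_⟩
    refine hi.congr (Eventually.of_forall fun x => ?_)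
    refine (hin x).symm.trans ?_
    refine integral_congr_ae (Eventually.of_forall fun y => ?_)
    exact (Real.norm_of_nonneg (mul_nonneg (φ0 x)
      (mul_nonneg (rker_pos hm hl _).le (h.rhs_nonneg y)))).symm
  refine ⟨hInt, ?_⟩
  rw [integral_prod _ hInt]
  simp only [hin]

lemma integrable_prod_rker_swap (hm : 0 < m) (hN : (N : ℝ) = 2 * m + 2) (hl : 0 < l) (hN0 : 0 < N)
    (h : IsDecayingSuper m w g) {φ : Euc N → ℝ} (hφ : AEStronglyMeasurable φ volume)
    (φ0 : ∀ x, 0 ≤ φ x) {T : Euc N → Euc N} (hT : Continuous T)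
    (hi : Integrable fun x => φ x * mollify m l w (T x)) :
    Integrable (fun q : Euc N × Euc N => φ q.2 * (rker m l (‖q.1 - T q.2‖ ^ 2) * g q.1))
        (volume.prod volume) ∧
      ∫ q : Euc N × Euc N, φ q.2 * (rker m l (‖q.1 - T q.2‖ ^ 2) * g q.1) ∂(volume.prod volume) =
        ∫ x, φ x * mollify m l w (T x) := by
  obtain ⟨h1, h2⟩ := integrable_prod_rker hm hN hl hN0 h hφ φ0 hT hi
  refine ⟨h1.swap, ?_⟩
  rw [← h2]
  exact integral_prod_swap (fun q : Euc N × Euc N =>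
    φ q.1 * (rker m l (‖q.2 - T q.1‖ ^ 2) * g q.2))

lemma integrable_mul_mollify (hm : 0 < m) (hN : (N : ℝ) = 2 * m + 2) (hl : 0 < l) (hN0 : 0 < N)
    (hu : IsDecayingSuper m u f) (hv : IsDecayingSuper m v g) (hi : Integrable fun x => f x * v x) :
    Integrable (fun x => f x * mollify m l v x) ∧
      ∫ x, f x * mollify m l v x ≤ kerMass N m * ∫ x, f x * v x := by
  have hle : ∀ x, f x * mollify m l v x ≤ kerMass N m * (f x * v x) := fun x => by
    rw [mul_left_comm]
    exact mul_le_mul_of_nonneg_left (hv.mollify_le hm hN hl x) (hu.rhs_nonneg x)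
  have hInt : Integrable fun x => f x * mollify m l v x := by
    refine (hi.const_mul (kerMass N m)).mono'
      ((aestronglyMeasurable_of_continuousOn hN0 hu.rhs_cont).mul
        (stronglyMeasurable_mollify hv.cont).aestronglyMeasurable)
      (Eventually.of_forall fun x => ?_)
    rw [Real.norm_of_nonneg (mul_nonneg (hu.rhs_nonneg x) (mollify_nonneg hm hl hv.nonneg x))]
    exact hle x
  refine ⟨hInt, ?_⟩
  rw [← integral_const_mul]
  exact integral_mono hInt (hi.const_mul _) hle

lemma integral_mul_mollify_comm (hm : 0 < m) (hN : (N : ℝ) = 2 * m + 2) (hl : 0 < l) (hN0 : 0 < N)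
    (hu : IsDecayingSuper m u f) (hv : IsDecayingSuper m v g)
    (i1 : Integrable fun x => f x * mollify m l v x)
    (i2 : Integrable fun x => g x * mollify m l u x) :
    ∫ x, f x * mollify m l v x = ∫ x, g x * mollify m l u x := by
  have h1 := (integrable_prod_rker hm hN hl hN0 hv
    (aestronglyMeasurable_of_continuousOn hN0 hu.rhs_cont) hu.rhs_nonneg continuous_id i1).2
  have h2 := (integrable_prod_rker_swap hm hN hl hN0 hu
    (aestronglyMeasurable_of_continuousOn hN0 hv.rhs_cont) hv.rhs_nonneg continuous_id i2).2
  simp only [id] at h1 h2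
  rw [← h1, ← h2]
  congr 1
  ext q
  rw [norm_sub_rev]
  ring

/-- Pointwise form of the convexity inequality for the kernel under a symmetric displacement. -/
lemma rker_displacement (hm : 0 < m) (hl : 0 < l) {L M t : ℝ} (ht : 0 ≤ t)
    {F : Euc N → Euc N}
    (hL : ∀ x y, inner ℝ (x - y) (F x - F y) ≤ L * ‖x - y‖ ^ 2) (hL0 : 0 ≤ L)
    (hM : ∀ x, ‖F x‖ ≤ M) (x y : Euc N) :
    (2 - (2 * t * L * m + 2 * t ^ 2 * M ^ 2 * (l * (m * (m + 2))))) * rker m l (‖y - x‖ ^ 2) ≤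
      rker m l (‖y - (x + t • F x)‖ ^ 2) + rker m l (‖x - (y + t • F y)‖ ^ 2) := by
  set S := ‖y - x‖ ^ 2 with hS
  have hS0 : 0 ≤ S := by positivity
  have hxy : ‖x - y‖ ^ 2 = S := by rw [hS, norm_sub_rev]
  have e1 : ‖y - (x + t • F x)‖ ^ 2 = S + 2 * t * inner ℝ (x - y) (F x) + t ^ 2 * ‖F x‖ ^ 2 := by
    rw [show y - (x + t • F x) = -((x - y) + t • F x) by abel, norm_neg, norm_add_sq_real, hxy,
      inner_smul_right, norm_smul, mul_pow, Real.norm_of_nonneg ht]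
    ring
  have e2 : ‖x - (y + t • F y)‖ ^ 2 = S - 2 * t * inner ℝ (x - y) (F y) + t ^ 2 * ‖F y‖ ^ 2 := by
    rw [show x - (y + t • F y) = (x - y) - t • F y by abel, norm_sub_sq_real, hxy,
      inner_smul_right, norm_smul, mul_pow, Real.norm_of_nonneg ht]
    ring
  have hin := hL x y
  rw [inner_sub_right, hxy] at hin
  have hk1 := rker1_nonpos hm hl S
  have hsum : ‖y - (x + t • F x)‖ ^ 2 - S + (‖x - (y + t • F y)‖ ^ 2 - S) ≤
      2 * t * L * S + 2 * t ^ 2 * M ^ 2 := by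
    rw [e1, e2]
    have a1 : ‖F x‖ ^ 2 ≤ M ^ 2 := pow_le_pow_left₀ (norm_nonneg _) (hM x) 2
    have a2 : ‖F y‖ ^ 2 ≤ M ^ 2 := pow_le_pow_left₀ (norm_nonneg _) (hM y) 2
    nlinarith [mul_le_mul_of_nonneg_left hin ht, mul_le_mul_of_nonneg_left a1 (sq_nonneg t),
      mul_le_mul_of_nonneg_left a2 (sq_nonneg t)]
  have c1 := rker_tangent hm hl (‖y - (x + t • F x)‖ ^ 2) S
  have c2 := rker_tangent hm hl (‖x - (y + t • F y)‖ ^ 2) S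
  have c3 := mul_le_mul_of_nonpos_left hsum hk1
  have c4 := mul_le_mul_of_nonneg_left (neg_mul_rker1_le hm hl S)
    (by positivity : 0 ≤ 2 * t * L)
  have c5 := mul_le_mul_of_nonneg_left (neg_rker1_le hm hl hS0)
    (by positivity : 0 ≤ 2 * t ^ 2 * M ^ 2)
  linarith

lemma displacement_ineq (hm : 0 < m) (hN : (N : ℝ) = 2 * m + 2) (hl : 0 < l) (hN0 : 0 < N)
    (hu : IsDecayingSuper m u f) (hv : IsDecayingSuper m v g) {L M t : ℝ} (ht : 0 ≤ t)
    {F : Euc N → Euc N} (hF : Continuous F)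
    (hL : ∀ x y, inner ℝ (x - y) (F x - F y) ≤ L * ‖x - y‖ ^ 2) (hL0 : 0 ≤ L)
    (hM : ∀ x, ‖F x‖ ≤ M)
    (i0 : Integrable fun x => f x * mollify m l v x)
    (i1 : Integrable fun x => f x * mollify m l v (x + t • F x))
    (i2 : Integrable fun x => g x * mollify m l u (x + t • F x)) :
    (2 - (2 * t * L * m + 2 * t ^ 2 * M ^ 2 * (l * (m * (m + 2))))) *
        ∫ x, f x * mollify m l v x ≤
      (∫ x, f x * mollify m l v (x + t • F x)) + ∫ x, g x * mollify m l u (x + t • F x) := by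
  have hf := aestronglyMeasurable_of_continuousOn hN0 hu.rhs_cont
  have hg := aestronglyMeasurable_of_continuousOn hN0 hv.rhs_cont
  have hT : Continuous fun x => x + t • F x := by fun_prop
  obtain ⟨a1, a2⟩ := integrable_prod_rker hm hN hl hN0 hv hf hu.rhs_nonneg continuous_id i0
  obtain ⟨b1, b2⟩ := integrable_prod_rker hm hN hl hN0 hv hf hu.rhs_nonneg hT i1
  obtain ⟨c1, c2⟩ := integrable_prod_rker_swap hm hN hl hN0 hu hg hv.rhs_nonneg hT i2
  simp only [id] at a1 a2
  rw [← a2, ← b2, ← c2, ← integral_add b1 c1, ← integral_const_mul]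
  refine integral_mono (a1.const_mul _) (b1.add c1) fun q => ?_
  simp only
  have h1 := mul_le_mul_of_nonneg_left (rker_displacement hm hl ht hL hL0 hM q.1 q.2)
    (mul_nonneg (hu.rhs_nonneg q.1) (hv.rhs_nonneg q.2))
  linarith

lemma integral_mollify_shift_le (hN0 : 0 < N)
    (hu : IsDecayingSuper m u f) (hv : IsDecayingSuper m v g) {F : Euc N → Euc N}
    (hF : Continuous F) {c d : ℝ} (hc : 0 < c) (hF0 : ∀ x, ‖x‖ ^ 2 ∉ Icc c d → F x = 0)
    {t ε : ℝ} (i0 : Integrable fun x => f x * mollify m l v x)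
    (hest : ∀ x, |mollify m l v (x + t • F x) - mollify m l v x -
      t * kerMass N m * fderiv ℝ v x (F x)| ≤ t * kerMass N m * ε) :
    Integrable (fun x => f x * mollify m l v (x + t • F x)) ∧
      ∫ x, f x * mollify m l v (x + t • F x) ≤ (∫ x, f x * mollify m l v x) +
        t * kerMass N m * ((∫ x, f x * fderiv ℝ v x (F x)) +
          ε * ∫ x in {x : Euc N | ‖x‖ ^ 2 ∈ Icc c d}, f x) := by
  set K := {x : Euc N | ‖x‖ ^ 2 ∈ Icc c d} with hK
  have hKc : IsCompact K := isCompact_annulus c d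
  have hf := aestronglyMeasurable_of_continuousOn hN0 hu.rhs_cont
  have hT : Continuous fun x => x + t • F x := by fun_prop
  have hdv : Integrable fun x => f x * fderiv ℝ v x (F x) := by
    refine integrable_of_annulus hc (d := d) ?_ fun x hx => by simp [hF0 x hx]
    exact hu.rhs_cont.mul ((hv.smooth.fderiv_of_isOpen (m := 1) isOpen_ne_zero
      (by norm_num)).continuousOn.clm_apply hF.continuousOn)
  have hχ : Integrable (K.indicator f) := by
    rw [integrable_indicator_iff hKc.measurableSet]
    exact (hu.rhs_cont.mono (annulus_subset hc)).integrableOn_compact hKc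
  have hmeas : AEStronglyMeasurable (fun x => f x * mollify m l v (x + t • F x)) volume :=
    hf.mul ((stronglyMeasurable_mollify hv.cont).comp_measurable hT.measurable).aestronglyMeasurable
  have hb : ∀ x, ‖f x * mollify m l v (x + t • F x) - f x * mollify m l v x -
      t * kerMass N m * (f x * fderiv ℝ v x (F x))‖ ≤ t * kerMass N m * ε * K.indicator f x := by
    intro x
    have e : f x * mollify m l v (x + t • F x) - f x * mollify m l v x -
        t * kerMass N m * (f x * fderiv ℝ v x (F x)) = f x * (mollify m l v (x + t • F x) -
          mollify m l v x - t * kerMass N m * fderiv ℝ v x (F x)) := by ring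
    by_cases hx : x ∈ K
    · rw [e, norm_mul, Real.norm_of_nonneg (hu.rhs_nonneg x), Real.norm_eq_abs,
        indicator_of_mem hx, mul_comm]
      exact mul_le_mul_of_nonneg_right (hest x) (hu.rhs_nonneg x)
    · rw [indicator_of_notMem hx, hF0 x hx]
      simp
  have hi : Integrable fun x => f x * mollify m l v (x + t • F x) - f x * mollify m l v x -
      t * kerMass N m * (f x * fderiv ℝ v x (F x)) :=
    (hχ.const_mul _).mono' ((hmeas.sub i0.1).sub (hdv.1.const_mul _)) (Eventually.of_forall hb)
  have hi1 : Integrable fun x => f x * mollify m l v (x + t • F x) := by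
    have := (hi.add i0).add (hdv.const_mul (t * kerMass N m))
    refine this.congr (Eventually.of_forall fun x => ?_)
    simp only [Pi.add_apply]
    ring
  refine ⟨hi1, ?_⟩
  have hle := (le_abs_self _).trans
    (norm_integral_le_of_norm_le (hχ.const_mul (t * kerMass N m * ε)) (Eventually.of_forall hb))
  have hsub : Integrable fun x => f x * mollify m l v (x + t • F x) - f x * mollify m l v x :=
    hi1.sub i0
  rw [integral_sub hsub (hdv.const_mul _), integral_sub hi1 i0, integral_const_mul,
    integral_const_mul, integral_indicator hKc.measurableSet] at hle
  linarith

/-- Rellich-type inequality: contracting the interaction energy along a vector field. -/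
lemma rellich_ineq (hm : 0 < m) (hN : (N : ℝ) = 2 * m + 2) (hN0 : 0 < N)
    (hu : IsDecayingSuper m u f) (hv : IsDecayingSuper m v g)
    (hfv : Integrable fun x => f x * v x) (hgu : Integrable fun x => g x * u x)
    {F : Euc N → Euc N} (hF : Continuous F) {L M c d : ℝ} (hc : 0 < c)
    (hF0 : ∀ x, ‖x‖ ^ 2 ∉ Icc c d → F x = 0)
    (hL : ∀ x y, inner ℝ (x - y) (F x - F y) ≤ L * ‖x - y‖ ^ 2) (hL0 : 0 ≤ L)
    (hM : ∀ x, ‖F x‖ ≤ M) :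
    -(2 * L * m) * min (∫ x, f x * v x) (∫ x, g x * u x) ≤
      (∫ x, f x * fderiv ℝ v x (F x)) + ∫ x, g x * fderiv ℝ u x (F x) := by
  have hκ := kerMass_pos (N := N) hm
  have hM0 : 0 ≤ M := (norm_nonneg _).trans (hM 0)
  set E := min (∫ x, f x * v x) (∫ x, g x * u x) with hE
  set I := (∫ x, f x * fderiv ℝ v x (F x)) + ∫ x, g x * fderiv ℝ u x (F x) with hI
  set K := (∫ x in {x : Euc N | ‖x‖ ^ 2 ∈ Icc c d}, f x) +
    ∫ x in {x : Euc N | ‖x‖ ^ 2 ∈ Icc c d}, g x with hK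
  have hε : ∀ ε, 0 < ε → -(2 * L * m) * E ≤ I + ε * K := by
    intro ε hε
    have hev : ∀ᶠ l : ℝ in atTop,
        -(2 * L * m + 2 * M ^ 2 * (m * (m + 2)) * l⁻¹) * E ≤ I + ε * K := by
      filter_upwards [eventually_gt_atTop 0,
        eventually_abs_mollify_sub_le hm hN hv.smooth hv.cont hc hM0 hF0 hM hε,
        eventually_abs_mollify_sub_le hm hN hu.smooth hu.cont hc hM0 hF0 hM hε] with l hl h1 h2
      have ht : 0 < (l ^ 2)⁻¹ := by positivity
      obtain ⟨i1, e1⟩ := integrable_mul_mollify hm hN hl hN0 hu hv hfv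
      obtain ⟨i2, e2⟩ := integrable_mul_mollify hm hN hl hN0 hv hu hgu
      have e3 := integral_mul_mollify_comm hm hN hl hN0 hu hv i1 i2
      obtain ⟨j1, s1⟩ := integral_mollify_shift_le hN0 hu hv hF hc hF0 i1 h1
      obtain ⟨j2, s2⟩ := integral_mollify_shift_le hN0 hv hu hF hc hF0 i2 h2
      have hd := displacement_ineq hm hN hl hN0 hu hv ht.le hF hL hL0 hM i1 j1 j2
      have hJ : ∫ x, f x * mollify m l v x ≤ kerMass N m * E := by
        rw [hE, mul_min_of_nonneg _ _ hκ.le]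
        exact le_min e1 (e3.le.trans e2)
      set J := ∫ x, f x * mollify m l v x
      set t := (l ^ 2)⁻¹ with htdef
      have htl : t * l = l⁻¹ := by rw [htdef]; field_simp
      have e4 : 2 * t * L * m + 2 * t ^ 2 * M ^ 2 * (l * (m * (m + 2))) =
          t * (2 * L * m + 2 * M ^ 2 * (m * (m + 2)) * l⁻¹) := by
        rw [← htl]; ring
      rw [e4] at hd
      set D := 2 * L * m + 2 * M ^ 2 * (m * (m + 2)) * l⁻¹ with hD
      have hD0 : 0 ≤ D := by positivity
      have h3 : -(t * D * J) ≤ t * kerMass N m * (I + ε * K) := by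
        rw [hI, hK]; rw [e3] at hd ⊢; linarith
      have h4 : t * D * J ≤ t * D * (kerMass N m * E) :=
        mul_le_mul_of_nonneg_left hJ (by positivity)
      have h5 : t * kerMass N m * (-D * E) ≤ t * kerMass N m * (I + ε * K) := by linarith
      exact le_of_mul_le_mul_left h5 (by positivity)
    refine le_of_tendsto ?_ hev
    have : Tendsto (fun l : ℝ => -(2 * L * m + 2 * M ^ 2 * (m * (m + 2)) * l⁻¹) * E) atTop
        (𝓝 (-(2 * L * m + 2 * M ^ 2 * (m * (m + 2)) * 0) * E)) :=
      ((tendsto_inv_atTop_zero.const_mul _).const_add _).neg.mul_const _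
    simpa using this
  have hlim : Tendsto (fun ε : ℝ => I + ε * K) (𝓝[>] 0) (𝓝 (I + 0 * K)) :=
    ((tendsto_id.mono_left nhdsWithin_le_nhds).mul_const K).const_add I
  have := ge_of_tendsto hlim (by filter_upwards [self_mem_nhdsWithin] with ε h using hε ε h)
  simpa using this

end PairInequality

section RadialField

variable {N : ℕ}

lemma IsLogCutoff.norm_smul_sub_le {C : ℝ} {n : ℕ} {t t1 t2 : ℝ → ℝ}
    (ht : IsLogCutoff C n t t1 t2) (x y : Euc N) :
    ‖t (‖x‖ ^ 2) • x - t (‖y‖ ^ 2) • y‖ ≤ (1 + 2 * (C / (n + 1))) * ‖x - y‖ := by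
  have hd : ∀ z : Euc N, HasFDerivAt (fun z : Euc N => t (‖z‖ ^ 2) • z)
      (t (‖z‖ ^ 2) • ContinuousLinearMap.id ℝ (Euc N) +
        (t1 (‖z‖ ^ 2) • (2 • innerSL ℝ z)).smulRight z) z := fun z =>
    ((ht.deriv0 _).comp_hasFDerivAt z (hasStrictFDerivAt_norm_sq z).hasFDerivAt).smul
      (hasFDerivAt_id z)
  refine Convex.norm_image_sub_le_of_norm_hasFDerivWithin_le
    (fun z _ => (hd z).hasFDerivWithinAt) (fun z _ => ?_) convex_univ (mem_univ y) (mem_univ x)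
  refine ContinuousLinearMap.opNorm_le_bound _ ?_ fun e => ?_
  · have := (abs_nonneg _).trans (ht.bound1 0)
    positivity
  have h1 : ‖t (‖z‖ ^ 2) • e‖ ≤ ‖e‖ := by
    rw [norm_smul, Real.norm_of_nonneg (ht.nonneg _)]
    exact mul_le_of_le_one_left (norm_nonneg _) (ht.le_one _)
  have h2 : ‖(t1 (‖z‖ ^ 2) * (2 * inner ℝ z e)) • z‖ ≤ 2 * (C / (n + 1)) * ‖e‖ := by
    have h3 := ht.bound1 (‖z‖ ^ 2)
    rw [abs_mul, abs_of_nonneg (by positivity)] at h3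
    rw [norm_smul, norm_mul, norm_mul, Real.norm_eq_abs, Real.norm_eq_abs, abs_two]
    have h4 := norm_inner_le_norm (𝕜 := ℝ) z e
    calc |t1 (‖z‖ ^ 2)| * (2 * ‖inner ℝ z e‖) * ‖z‖
        ≤ |t1 (‖z‖ ^ 2)| * (2 * (‖z‖ * ‖e‖)) * ‖z‖ := by gcongr
      _ = 2 * (‖z‖ ^ 2 * |t1 (‖z‖ ^ 2)|) * ‖e‖ := by ring
      _ ≤ _ := by gcongr
  have h5 := norm_add_le (t (‖z‖ ^ 2) • e) ((t1 (‖z‖ ^ 2) * (2 * inner ℝ z e)) • z)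
  have h6 : (t (‖z‖ ^ 2) • ContinuousLinearMap.id ℝ (Euc N) +
      (t1 (‖z‖ ^ 2) • (2 • innerSL ℝ z)).smulRight z) e =
      t (‖z‖ ^ 2) • e + (t1 (‖z‖ ^ 2) * (2 * inner ℝ z e)) • z := by
    simp
  rw [h6]
  linarith

lemma IsLogCutoff.inner_smul_sub_le {C : ℝ} {n : ℕ} {t t1 t2 : ℝ → ℝ}
    (ht : IsLogCutoff C n t t1 t2) (x y : Euc N) :
    inner ℝ (x - y) (t (‖x‖ ^ 2) • x - t (‖y‖ ^ 2) • y) ≤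
      (1 + 2 * (C / (n + 1))) * ‖x - y‖ ^ 2 := by
  have h1 := real_inner_le_norm (x - y) (t (‖x‖ ^ 2) • x - t (‖y‖ ^ 2) • y)
  have h2 := mul_le_mul_of_nonneg_left (ht.norm_smul_sub_le x y) (norm_nonneg (x - y))
  linarith

lemma IsLogCutoff.norm_smul_le {C : ℝ} {n : ℕ} {t t1 t2 : ℝ → ℝ}
    (ht : IsLogCutoff C n t t1 t2) {c d : ℝ} (h0 : ∀ s, s ∉ Icc c d → t s = 0) (x : Euc N) :
    ‖t (‖x‖ ^ 2) • x‖ ≤ √d := by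
  by_cases hx : ‖x‖ ^ 2 ∈ Icc c d
  · rw [norm_smul, Real.norm_of_nonneg (ht.nonneg _)]
    exact (mul_le_of_le_one_left (norm_nonneg _) (ht.le_one _)).trans (Real.le_sqrt_of_sq_le hx.2)
  · simp [h0 _ hx]

lemma IsLogCutoff.hasDerivAt_rpow_mul {C : ℝ} {n : ℕ} {t t1 t2 : ℝ → ℝ}
    (ht : IsLogCutoff C n t t1 t2) (e s : ℝ) :
    HasDerivAt (fun s => s ^ e * t s) (e * s ^ (e - 1) * t s + s ^ e * t1 s) s := by
  rcases eq_or_ne s 0 with rfl | hs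
  · obtain ⟨c, d, hc, -, h0⟩ := ht.supp
    have hz : ∀ s < c, t s = 0 ∧ t1 s = 0 ∧ t2 s = 0 := fun s hs => h0 s fun h => absurd h.1 hs.not_ge
    rw [(hz 0 hc).1, (hz 0 hc).2.1]
    refine ((hasDerivAt_const (0 : ℝ) (0 : ℝ)).congr_of_eventuallyEq ?_).congr_deriv (by simp)
    filter_upwards [gt_mem_nhds hc] with s hs
    rw [(hz s hs).1, mul_zero]
  · exact (Real.hasDerivAt_rpow_const (Or.inl hs)).mul (ht.deriv0 s)

lemma sum_coord_mul_apply (D : Euc N →L[ℝ] ℝ) (y : Euc N) :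
    ∑ i, y i * D (EuclideanSpace.single i (1 : ℝ)) = D y := by
  conv_rhs => rw [← (EuclideanSpace.basisFun (Fin N) ℝ).sum_repr y]
  simp [map_sum]

/-- Pohozaev-type integration by parts along a truncated radial field. -/
lemma integral_rpow_mul_fderiv_radial {C : ℝ} {n : ℕ} {t t1 t2 : ℝ → ℝ}
    (ht : IsLogCutoff C n t t1 t2) {w : Euc N → ℝ} (hw : ContDiffOn ℝ 2 w {x | x ≠ 0})
    (hwc : Continuous w) {p : ℝ} (hp : 0 < p) (a : ℝ) :
    (p + 1) * ∫ x, ‖x‖ ^ a * w x ^ p * fderiv ℝ w x (t (‖x‖ ^ 2) • x) =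
      -∫ x, ‖x‖ ^ a * w x ^ (p + 1) * ((N + a) * t (‖x‖ ^ 2) + 2 * (‖x‖ ^ 2 * t1 (‖x‖ ^ 2))) := by
  obtain ⟨c, d, hc, -, h0⟩ := ht.supp
  set K : ℝ → ℝ := fun s => s ^ (a / 2) * t s with hK
  set K1 : ℝ → ℝ := fun s => a / 2 * s ^ (a / 2 - 1) * t s + s ^ (a / 2) * t1 s with hK1
  have hKd : ∀ s, HasDerivAt K (K1 s) s := ht.hasDerivAt_rpow_mul (a / 2)
  have htc : Continuous t := continuous_iff_continuousAt.2 fun s => (ht.deriv0 s).continuousAt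
  have ht1c : Continuous t1 := continuous_iff_continuousAt.2 fun s => (ht.deriv1 s).continuousAt
  have hKc : Continuous K := continuous_iff_continuousAt.2 fun s => (hKd s).continuousAt
  have hsq : Continuous fun x : Euc N => ‖x‖ ^ 2 := by fun_prop
  have hwp : Continuous fun x => w x ^ p := hwc.rpow_const fun x => Or.inr hp.le
  have hwp1 : Continuous fun x => w x ^ (p + 1) :=
    hwc.rpow_const fun x => Or.inr (by linarith)
  have hpow : ∀ e : ℝ, ContinuousOn (fun x : Euc N => (‖x‖ ^ 2) ^ e) {x | x ≠ 0} := fun e x hx =>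
    (hsq.continuousAt.rpow_const (Or.inl (norm_sq_pos hx).ne')).continuousWithinAt
  have hK1c : ContinuousOn (fun x : Euc N => K1 (‖x‖ ^ 2)) {x | x ≠ 0} :=
    (((hpow _).const_mul _).mul (htc.comp hsq).continuousOn).add
      ((hpow _).mul (ht1c.comp hsq).continuousOn)
  have hKc' : ContinuousOn (fun x : Euc N => K (‖x‖ ^ 2)) {x | x ≠ 0} :=
    (hKc.comp hsq).continuousOn
  have hdw : ContinuousOn (fderiv ℝ w) {x | x ≠ 0} :=
    (hw.fderiv_of_isOpen (m := 1) isOpen_ne_zero (by norm_num)).continuousOn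
  have hK0 : ∀ x : Euc N, ‖x‖ ^ 2 ∉ Icc c d → K (‖x‖ ^ 2) = 0 := fun x hx => by
    simp [hK, (h0 _ hx).1]
  have hK10 : ∀ x : Euc N, ‖x‖ ^ 2 ∉ Icc c d → K1 (‖x‖ ^ 2) = 0 := fun x hx => by
    simp [hK1, (h0 _ hx).1, (h0 _ hx).2.1]
  set φ' : Fin N → Euc N → ℝ := fun i x =>
    (2 * K1 (‖x‖ ^ 2) * x i * x i + K (‖x‖ ^ 2)) * w x ^ (p + 1) +
      K (‖x‖ ^ 2) * x i * (fderiv ℝ w x (EuclideanSpace.single i (1 : ℝ)) * (p + 1) * w x ^ p)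
    with hφ'
  have key : ∀ i, Integrable (φ' i) ∧ ∫ x, φ' i x = 0 := by
    intro i
    have hci : ContinuousOn (fun x : Euc N => x i) {x | x ≠ 0} := by fun_prop
    refine integral_lineDeriv_eq_zero (φ := fun x => K (‖x‖ ^ 2) * x i * w x ^ (p + 1))
      (e := EuclideanSpace.single i (1 : ℝ)) hc (d := d) ((hKc'.mul hci).mul hwp1.continuousOn)
      ?_ (fun x hx => by simp [hK0 x hx]) (fun x hx => by simp [hφ', hK0 x hx, hK10 x hx]) ?_
    · exact (((((hK1c.const_mul 2).mul hci).mul hci).add hKc').mul hwp1.continuousOn).add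
        ((hKc'.mul hci).mul (((hdw.clm_apply continuousOn_const).mul_const _).mul
          hwp.continuousOn))
    · intro x hx
      have h1 := hasLineDerivAt_radial hKd 0 x i
      have h2 := hasLineDerivAt_coord 0 x i
      have h3 : HasLineDerivAt ℝ w (fderiv ℝ w x (EuclideanSpace.single i (1 : ℝ))) x
          (EuclideanSpace.single i (1 : ℝ)) :=
        (((hw x hx).contDiffAt (isOpen_ne_zero.mem_nhds hx)).differentiableAt
          (by norm_num)).hasFDerivAt.hasLineDerivAt _
      have h4 : HasLineDerivAt ℝ (fun y => w y ^ (p + 1))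
          (fderiv ℝ w x (EuclideanSpace.single i (1 : ℝ)) * (p + 1) * w x ^ p) x
          (EuclideanSpace.single i (1 : ℝ)) := by
        unfold HasLineDerivAt at h3 ⊢
        refine (h3.rpow_const (p := p + 1) (Or.inr (by linarith))).congr_deriv ?_
        simp
      have h5 := (h1.mul_real h2).mul_real h4
      simp only [sub_zero, PiLp.zero_apply, mul_one] at h5
      exact h5
  have hsum : ∫ x, ∑ i, φ' i x = 0 := by
    rw [integral_finsetSum _ fun i _ => (key i).1]
    exact Finset.sum_eq_zero fun i _ => (key i).2
  have hKeq : ∀ x : Euc N, K (‖x‖ ^ 2) = ‖x‖ ^ a * t (‖x‖ ^ 2) := fun x => by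
    simp only [hK]
    rw [← Real.rpow_natCast, ← Real.rpow_mul (norm_nonneg x)]
    congr 2
    push_cast; ring
  have hK1eq : ∀ x : Euc N, x ≠ 0 → ‖x‖ ^ 2 * K1 (‖x‖ ^ 2) =
      ‖x‖ ^ a * (a / 2 * t (‖x‖ ^ 2) + ‖x‖ ^ 2 * t1 (‖x‖ ^ 2)) := fun x hx => by
    have e1 : ‖x‖ ^ a = (‖x‖ ^ 2) ^ (a / 2) := by
      rw [← Real.rpow_natCast, ← Real.rpow_mul (norm_nonneg x)]
      congr 1
      push_cast; ring
    simp only [hK1]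
    rw [e1, Real.rpow_sub_one (norm_sq_pos hx).ne']
    have := (norm_sq_pos hx).ne'
    field_simp
  have hpowa : ContinuousOn (fun x : Euc N => ‖x‖ ^ a) {x | x ≠ 0} := fun x hx =>
    (continuous_norm.continuousAt.rpow_const (Or.inl (norm_ne_zero_iff.2 hx))).continuousWithinAt
  have i1 : Integrable fun x => ‖x‖ ^ a * w x ^ p * fderiv ℝ w x (t (‖x‖ ^ 2) • x) := by
    refine integrable_of_annulus hc (d := d) ?_ fun x hx => by simp [(h0 _ hx).1]
    exact (hpowa.mul hwp.continuousOn).mul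
      (hdw.clm_apply ((htc.comp hsq).smul continuous_id).continuousOn)
  have i2 : Integrable fun x => ‖x‖ ^ a * w x ^ (p + 1) *
      ((N + a) * t (‖x‖ ^ 2) + 2 * (‖x‖ ^ 2 * t1 (‖x‖ ^ 2))) := by
    refine integrable_of_annulus hc (d := d) ?_ fun x hx => by simp [(h0 _ hx).1, (h0 _ hx).2.1]
    refine (hpowa.mul hwp1.continuousOn).mul (Continuous.continuousOn ?_)
    have := htc.comp hsq
    have := ht1c.comp hsq
    fun_prop
  have hpt : ∀ x : Euc N, x ≠ 0 → ∑ i, φ' i x =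
      (p + 1) * (‖x‖ ^ a * w x ^ p * fderiv ℝ w x (t (‖x‖ ^ 2) • x)) +
        ‖x‖ ^ a * w x ^ (p + 1) * ((N + a) * t (‖x‖ ^ 2) + 2 * (‖x‖ ^ 2 * t1 (‖x‖ ^ 2))) := by
    intro x hx
    have e1 : ∑ i, φ' i x = 2 * w x ^ (p + 1) * (K1 (‖x‖ ^ 2) * ∑ i, x i ^ 2) +
        N * (K (‖x‖ ^ 2) * w x ^ (p + 1)) + (p + 1) * w x ^ p * K (‖x‖ ^ 2) *
          ∑ i, x i * fderiv ℝ w x (EuclideanSpace.single i (1 : ℝ)) := by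
      have : (N : ℝ) * (K (‖x‖ ^ 2) * w x ^ (p + 1)) =
          ∑ _i : Fin N, K (‖x‖ ^ 2) * w x ^ (p + 1) := by simp
      rw [this, Finset.mul_sum, Finset.mul_sum, Finset.mul_sum, ← Finset.sum_add_distrib,
        ← Finset.sum_add_distrib]
      refine Finset.sum_congr rfl fun i _ => ?_
      simp only [hφ']
      ring
    rw [e1, sum_sq_eq, sum_coord_mul_apply, mul_comm (K1 _), hK1eq x hx, hKeq, map_smul,
      smul_eq_mul]
    ring
  rcases Nat.eq_zero_or_pos N with hN | hN
  · subst hN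
    have hz : ∀ x : Euc 0, t (‖x‖ ^ 2) = 0 ∧ t1 (‖x‖ ^ 2) = 0 := fun x => by
      have : x = 0 := Subsingleton.elim _ _
      have h := h0 (‖x‖ ^ 2) (by subst this; simpa using fun h => absurd h hc.not_ge)
      exact ⟨h.1, h.2.1⟩
    simp [hz]
  · rw [integral_congr_ae ((ae_ne_zero hN).mono hpt),
      integral_add (i1.const_mul _) i2, integral_const_mul] at hsum
    linarith

lemma tendsto_integral_rpow_mul_fderiv_radial (hN : 0 < N) {C : ℝ} {t t1 t2 : ℕ → ℝ → ℝ}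
    (ht : ∀ n, IsLogCutoff C n (t n) (t1 n) (t2 n)) {w : Euc N → ℝ}
    (hw : ContDiffOn ℝ 2 w {x | x ≠ 0}) (hwc : Continuous w) (hw0 : ∀ x, 0 ≤ w x) {p a : ℝ}
    (hp : 0 < p) (hi : Integrable fun x => ‖x‖ ^ a * w x ^ (p + 1)) :
    Tendsto (fun n => ∫ x, ‖x‖ ^ a * w x ^ p * fderiv ℝ w x (t n (‖x‖ ^ 2) • x)) atTop
      (𝓝 (-((N + a) / (p + 1) * ∫ x, ‖x‖ ^ a * w x ^ (p + 1)))) := by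
  have hC : 0 ≤ C := by
    have := (abs_nonneg _).trans ((ht 0).bound1 0)
    simpa using this
  have hlim : Tendsto (fun n => ∫ x, ‖x‖ ^ a * w x ^ (p + 1) *
      ((N + a) * t n (‖x‖ ^ 2) + 2 * (‖x‖ ^ 2 * t1 n (‖x‖ ^ 2)))) atTop
      (𝓝 (∫ x, ‖x‖ ^ a * w x ^ (p + 1) * (N + a))) := by
    have hsq : Continuous fun x : Euc N => ‖x‖ ^ 2 := by fun_prop
    refine tendsto_integral_of_dominated_convergence
      (fun x => ‖x‖ ^ a * w x ^ (p + 1) * (|(N : ℝ) + a| + 2 * C)) (fun n => ?_)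
      (hi.mul_const _) (fun n => Eventually.of_forall fun x => ?_) ?_
    · have h1 : Continuous fun x : Euc N => t n (‖x‖ ^ 2) :=
        (continuous_iff_continuousAt.2 fun s => ((ht n).deriv0 s).continuousAt).comp hsq
      have h2 : Continuous fun x : Euc N => t1 n (‖x‖ ^ 2) :=
        (continuous_iff_continuousAt.2 fun s => ((ht n).deriv1 s).continuousAt).comp hsq
      exact hi.1.mul
        ((continuous_const.mul h1).add (continuous_const.mul (hsq.mul h2))).aestronglyMeasurable
    · have hb0 : 0 ≤ ‖x‖ ^ a * w x ^ (p + 1) :=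
        mul_nonneg (by positivity) (Real.rpow_nonneg (hw0 x) _)
      rw [norm_mul, Real.norm_of_nonneg hb0, Real.norm_eq_abs]
      refine mul_le_mul_of_nonneg_left ?_ hb0
      have h1 := abs_add_le (((N : ℝ) + a) * t n (‖x‖ ^ 2)) (2 * (‖x‖ ^ 2 * t1 n (‖x‖ ^ 2)))
      have h2 : |((N : ℝ) + a) * t n (‖x‖ ^ 2)| ≤ |(N : ℝ) + a| := by
        rw [abs_mul, abs_of_nonneg ((ht n).nonneg _)]
        exact mul_le_of_le_one_right (abs_nonneg _) ((ht n).le_one _)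
      have h3 : |2 * (‖x‖ ^ 2 * t1 n (‖x‖ ^ 2))| ≤ 2 * C := by
        rw [abs_mul, abs_two]
        have := (ht n).bound1 (‖x‖ ^ 2)
        have h4 : C / ((n : ℝ) + 1) ≤ C := div_le_self hC (by linarith [n.cast_nonneg (α := ℝ)])
        linarith
      linarith
    · filter_upwards [ae_ne_zero hN] with x hx
      have h1 := IsLogCutoff.tendsto_one ht (norm_sq_pos hx)
      have h2 : Tendsto (fun n => ‖x‖ ^ 2 * t1 n (‖x‖ ^ 2)) atTop (𝓝 0) := by
        refine squeeze_zero_norm (fun n => (ht n).bound1 (‖x‖ ^ 2)) ?_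
        exact tendsto_const_div_atTop_nhds_zero_nat C |>.comp (tendsto_add_atTop_nat 1) |>.congr
          fun n => by simp
      have h3 := ((h1.const_mul ((N : ℝ) + a)).add (h2.const_mul 2)).const_mul
        (‖x‖ ^ a * w x ^ (p + 1))
      simpa using h3
  have heq : ∀ n, ∫ x, ‖x‖ ^ a * w x ^ p * fderiv ℝ w x (t n (‖x‖ ^ 2) • x) =
      -(p + 1)⁻¹ * ∫ x, ‖x‖ ^ a * w x ^ (p + 1) *
        ((N + a) * t n (‖x‖ ^ 2) + 2 * (‖x‖ ^ 2 * t1 n (‖x‖ ^ 2))) := fun n => by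
    have h := integral_rpow_mul_fderiv_radial (ht n) hw hwc hp a
    have hp1 : p + 1 ≠ 0 := by linarith
    rw [neg_mul, ← mul_neg, ← h, inv_mul_cancel_left₀ hp1]
  simp only [heq]
  convert hlim.const_mul (-(p + 1)⁻¹) using 2
  rw [integral_mul_const]
  ring

end RadialField

section Liouville

variable {N : ℕ}

lemma isDecayingSuper_of_integrable (hN : 3 ≤ N) {m : ℝ} (hm : (N : ℝ) = 2 * m + 2)
    {w z : Euc N → ℝ} (hw : ContDiffOn ℝ 2 w {x | x ≠ 0}) (hwc : Continuous w)
    (hw0 : ∀ x, 0 ≤ w x) (hzc : Continuous z) (hz0 : ∀ x, 0 ≤ z x) {p q a b : ℝ}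
    (hp : 0 < p) (hq : 0 < q) (hb : -2 < b)
    (heq : ∀ x, x ≠ 0 → -lap w x = ‖x‖ ^ a * (|z x| ^ (p - 1) * z x))
    (hi : Integrable fun x => ‖x‖ ^ b * w x ^ (q + 1)) :
    IsDecayingSuper m w fun x => ‖x‖ ^ a * z x ^ p where
  smooth := hw
  cont := hwc
  nonneg := hw0
  eqn x hx := by
    rw [heq x hx, abs_of_nonneg (hz0 x)]
    congr 1
    rcases (hz0 x).eq_or_lt with h | h
    · rw [← h, mul_zero, Real.zero_rpow hp.ne']
    · rw [Real.rpow_sub_one h.ne', div_mul_cancel₀ _ h.ne']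
  rhs_cont := by
    have hpowa : ContinuousOn (fun x : Euc N => ‖x‖ ^ a) {x | x ≠ 0} := fun x hx =>
      (continuous_norm.continuousAt.rpow_const (Or.inl (norm_ne_zero_iff.2 hx))).continuousWithinAt
    exact hpowa.mul (hzc.rpow_const fun x => Or.inr hp.le).continuousOn
  rhs_nonneg x := mul_nonneg (by positivity) (Real.rpow_nonneg (hz0 x) _)
  decay := integrable_mul_decay (by omega) hwc hw0 hq hb hm hi

lemma eq_zero_of_integral_eq_zero (hN : 0 < N) {w : Euc N → ℝ} (hwc : Continuous w)
    (hw0 : ∀ x, 0 ≤ w x) {r a : ℝ} (hr : 0 < r) (hi : Integrable fun x => ‖x‖ ^ a * w x ^ r)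
    (h : ∫ x, ‖x‖ ^ a * w x ^ r = 0) : ∀ x, w x = 0 := by
  have h1 := (integral_eq_zero_iff_of_nonneg
    (fun x => mul_nonneg (by positivity) (Real.rpow_nonneg (hw0 x) _)) hi).1 h
  have h2 : w =ᵐ[volume] fun _ => 0 := by
    filter_upwards [h1, ae_ne_zero hN] with x hx hx0
    have h3 : (0 : ℝ) < ‖x‖ ^ a := Real.rpow_pos_of_pos (norm_pos_iff.2 hx0) _
    have h4 : w x ^ r = 0 := by simpa [h3.ne'] using hx
    exact (Real.rpow_eq_zero (hw0 x) hr.ne').1 h4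
  exact congrFun ((hwc.ae_eq_iff_eq volume continuous_const).1 h2)

/-- A nonnegative solution with finite weighted energies satisfies a Rellich–Pohozaev inequality. -/
lemma rellich_pohozaev_le (hN : 3 ≤ N) {p q a b : ℝ} (hp : 0 < p) (hq : 0 < q)
    (ha : -2 < a) (hb : -2 < b) {u v : Euc N → ℝ} (hsol : IsHLESol p q a b u v)
    (hu : ∀ x, 0 ≤ u x) (hv : ∀ x, 0 ≤ v x)
    (iv : Integrable fun x => ‖x‖ ^ a * v x ^ (p + 1))
    (iu : Integrable fun x => ‖x‖ ^ b * u x ^ (q + 1)) :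
    (N + a) / (p + 1) * (∫ x, ‖x‖ ^ a * v x ^ (p + 1)) +
        (N + b) / (q + 1) * ∫ x, ‖x‖ ^ b * u x ^ (q + 1) ≤
      (N - 2) * min (∫ x, ‖x‖ ^ a * v x ^ (p + 1)) (∫ x, ‖x‖ ^ b * u x ^ (q + 1)) := by
  obtain ⟨su, sv, cu, cv, equ, eqv⟩ := hsol
  set m : ℝ := (N - 2) / 2 with hm
  have hNm : (N : ℝ) = 2 * m + 2 := by rw [hm]; ring
  have hN3 : (3 : ℝ) ≤ N := by exact_mod_cast hN
  have hm0 : 0 < m := by linarith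
  have hN0 : 0 < N := by omega
  have Hu := isDecayingSuper_of_integrable hN hNm su cu hu cv hv hp hq hb equ iu
  have Hv := isDecayingSuper_of_integrable hN hNm sv cv hv cu hu hq hp ha eqv iv
  have mul_rpow : ∀ {c y r : ℝ}, 0 ≤ y → 0 < r → c * y ^ r * y = c * y ^ (r + 1) :=
    fun hy hr => by rw [Real.rpow_add_one' hy (by linarith), mul_assoc]
  have efv : ∀ x, ‖x‖ ^ a * v x ^ p * v x = ‖x‖ ^ a * v x ^ (p + 1) := fun x => mul_rpow (hv x) hp
  have egu : ∀ x, ‖x‖ ^ b * u x ^ q * u x = ‖x‖ ^ b * u x ^ (q + 1) := fun x => mul_rpow (hu x) hq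
  obtain ⟨C, hC, hcut⟩ := exists_logCutoff
  choose t t1 t2 ht using hcut
  set A := ∫ x, ‖x‖ ^ a * v x ^ (p + 1)
  set B := ∫ x, ‖x‖ ^ b * u x ^ (q + 1)
  have hn : ∀ n : ℕ, -(2 * (1 + 2 * (C / (n + 1))) * m) * min A B ≤
      (∫ x, ‖x‖ ^ a * v x ^ p * fderiv ℝ v x (t n (‖x‖ ^ 2) • x)) +
        ∫ x, ‖x‖ ^ b * u x ^ q * fderiv ℝ u x (t n (‖x‖ ^ 2) • x) := by
    intro n
    obtain ⟨c, d, hc, -, h0⟩ := (ht n).supp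
    have htc : Continuous (t n) :=
      continuous_iff_continuousAt.2 fun s => ((ht n).deriv0 s).continuousAt
    have h := rellich_ineq hm0 hNm hN0 Hu Hv (by simpa only [efv] using iv)
      (by simpa only [egu] using iu) (F := fun x => t n (‖x‖ ^ 2) • x) (by fun_prop) hc (d := d)
      (fun x hx => by simp [(h0 _ hx).1]) (ht n).inner_smul_sub_le (by positivity)
      ((ht n).norm_smul_le fun s hs => (h0 s hs).1)
    simpa only [efv, egu] using h
  have l1 := tendsto_integral_rpow_mul_fderiv_radial hN0 ht sv cv hv hp iv
  have l2 := tendsto_integral_rpow_mul_fderiv_radial hN0 ht su cu hu hq iu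
  have l3 : Tendsto (fun n : ℕ => -(2 * (1 + 2 * (C / (n + 1))) * m) * min A B) atTop
      (𝓝 (-(2 * (1 + 2 * 0) * m) * min A B)) := by
    have h4 : Tendsto (fun n : ℕ => C / ((n : ℝ) + 1)) atTop (𝓝 0) :=
      tendsto_const_div_atTop_nhds_zero_nat C |>.comp (tendsto_add_atTop_nat 1) |>.congr
        fun n => by simp
    exact ((((h4.const_mul 2).const_add 1).const_mul 2).mul_const m).neg.mul_const _
  have hfin := le_of_tendsto_of_tendsto' l3 (l1.add l2) hn
  have hm2 : (N : ℝ) - 2 = 2 * m := by linarith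
  rw [hm2]
  linarith

/-- The annular bound splits into bounds for the two nonnegative summands. -/
lemma integral_annulus_le_of_add {φ ψ : Euc N → ℝ} (hφ : Continuous φ) (hψ : Continuous ψ)
    (hφ0 : ∀ x, 0 ≤ φ x) {R₁ R₄ C₀ : ℝ}
    (h : ∫ x in ball (0 : Euc N) R₄ \ ball 0 R₁, (ψ x + φ x) ≤ C₀) :
    ∫ x in ball (0 : Euc N) R₄ \ ball 0 R₁, ψ x ≤ C₀ := by
  have hI : ∀ {χ : Euc N → ℝ}, Continuous χ →
      IntegrableOn χ (ball (0 : Euc N) R₄ \ ball 0 R₁) := fun hχ =>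
    (hχ.continuousOn.integrableOn_compact (isCompact_closedBall (0 : Euc N) R₄)).mono_set
      (sdiff_subset.trans ball_subset_closedBall)
  refine (integral_mono (hI hψ) (hI (hψ.add hφ)) fun x => ?_).trans h
  exact le_add_of_nonneg_right (hφ0 x)

lemma eq_zero_of_mul_add_mul_le_mul_min {A B c d k : ℝ} (hA : 0 ≤ A) (hB : 0 ≤ B) (hc : 0 < c)
    (hd : 0 < d) (hk : k < c + d) (h : c * A + d * B ≤ k * min A B) : A = 0 ∧ B = 0 := by
  have hE : 0 ≤ min A B := le_min hA hB
  have h1 := mul_le_mul_of_nonneg_left (min_le_left A B) hc.le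
  have h2 := mul_le_mul_of_nonneg_left (min_le_right A B) hd.le
  have hE0 : min A B = 0 := by
    by_contra hne
    have hpos : 0 < min A B := lt_of_le_of_ne hE (Ne.symm hne)
    nlinarith
  rw [hE0, mul_zero] at h
  have h3 := mul_nonneg hc.le hA
  have h4 := mul_nonneg hd.le hB
  exact ⟨(mul_eq_zero.1 (by linarith : c * A = 0)).resolve_left hc.ne',
    (mul_eq_zero.1 (by linarith : d * B = 0)).resolve_left hd.ne'⟩

end Liouville

/-- Theorem 1.6: a nonnegative solution of the subcritical Hénon–Lane–Emden system with a
uniform bound on the rescaled energy on an annulus is identically zero. -/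
theorem stmt_3 (N : ℕ) (hN : 3 ≤ N) (p q a b : ℝ)
    (hp : 0 < p) (hq : 0 < q) (hpq : 1 < p * q)
    (ha : -2 < a) (hb : -2 < b)
    (hsub : ((N : ℝ) + a) / (p + 1) + ((N : ℝ) + b) / (q + 1) > (N : ℝ) - 2)
    (u v : Euc N → ℝ)
    (hsol : IsHLESol p q a b u v) (hu : ∀ x, 0 ≤ u x) (hv : ∀ x, 0 ≤ v x)
    (h : ∃ R₄ R₁ C₀ Rstar : ℝ, 0 < R₁ ∧ R₁ < R₄ ∧ 0 < C₀ ∧ 0 < Rstar ∧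
      ∀ R : ℝ, Rstar ≤ R →
        (∫ x in ball (0 : Euc N) R₄ \ ball 0 R₁,
          ((R ^ ((2 * (p + 1) + a + p * b) / (p * q - 1)) * u (R • x)) ^ (q + 1) +
           (R ^ ((2 * (q + 1) + b + q * a) / (p * q - 1)) * v (R • x)) ^ (p + 1))) ≤ C₀) :
    ∀ x, u x = 0 ∧ v x = 0 := by
  obtain ⟨R₄, R₁, C₀, Rs, hR₁, hR, -, hRs, hbd⟩ := h
  have cu : Continuous u := hsol.2.2.1
  have cv : Continuous v := hsol.2.2.2.1
  have hN3 : (3 : ℝ) ≤ N := by exact_mod_cast hN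
  have hN0 : 0 < N := by omega
  set α := (2 * (p + 1) + a + p * b) / (p * q - 1) with hα
  set β := (2 * (q + 1) + b + q * a) / (p * q - 1) with hβ
  have hpq1 : 0 < p * q - 1 := by linarith
  have hp1 : 0 < p + 1 := by linarith
  have hq1 : 0 < q + 1 := by linarith
  have hαβ : (N : ℝ) - 2 < α + β := by
    have h1 : ((N : ℝ) - 2) * ((p + 1) * (q + 1)) <
        ((N : ℝ) + a) * (q + 1) + ((N : ℝ) + b) * (p + 1) := by
      rw [gt_iff_lt, div_add_div _ _ hp1.ne' hq1.ne', lt_div_iff₀ (by positivity)] at hsub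
      linarith
    rw [hα, hβ, ← add_div, lt_div_iff₀ hpq1]
    linarith
  have mα : α * (p * q - 1) = 2 * (p + 1) + a + p * b := div_mul_cancel₀ _ hpq1.ne'
  have mβ : β * (p * q - 1) = 2 * (q + 1) + b + q * a := div_mul_cancel₀ _ hpq1.ne'
  have eα : α * (q + 1) = α + β + 2 + b := by
    refine mul_right_cancel₀ hpq1.ne' ?_
    linear_combination q * mα - mβ
  have eβ : β * (p + 1) = α + β + 2 + a := by
    refine mul_right_cancel₀ hpq1.ne' ?_
    linear_combination p * mβ - mα
  have hcu : ∀ R : ℝ, Continuous fun x : Euc N => (R ^ α * u (R • x)) ^ (q + 1) := fun R =>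
    Continuous.rpow_const (by fun_prop) fun x => Or.inr hq1.le
  have hcv : ∀ R : ℝ, Continuous fun x : Euc N => (R ^ β * v (R • x)) ^ (p + 1) := fun R =>
    Continuous.rpow_const (by fun_prop) fun x => Or.inr hp1.le
  have iu : Integrable fun x => ‖x‖ ^ b * u x ^ (q + 1) := by
    refine integrable_of_rescaled_bound hN0 cu hu hq1 (by linarith) (A := α) (C₀ := C₀) (by linarith)
      hR₁ hR hRs fun R hR' => ?_
    refine integral_annulus_le_of_add (hcv R) (hcu R) (fun x => ?_) (hbd R hR')
    have : 0 < R := hRs.trans_le hR'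
    exact Real.rpow_nonneg (mul_nonneg (by positivity) (hv _)) _
  have iv : Integrable fun x => ‖x‖ ^ a * v x ^ (p + 1) := by
    refine integrable_of_rescaled_bound hN0 cv hv hp1 (by linarith) (A := β) (C₀ := C₀) (by linarith)
      hR₁ hR hRs fun R hR' => ?_
    refine integral_annulus_le_of_add (hcu R) (hcv R) (fun x => ?_) ?_
    · have : 0 < R := hRs.trans_le hR'
      exact Real.rpow_nonneg (mul_nonneg (by positivity) (hu _)) _
    · simpa only [add_comm] using hbd R hR'
  obtain ⟨hA, hB⟩ := eq_zero_of_mul_add_mul_le_mul_min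
    (integral_nonneg fun x => mul_nonneg (by positivity) (Real.rpow_nonneg (hv x) _))
    (integral_nonneg fun x => mul_nonneg (by positivity) (Real.rpow_nonneg (hu x) _))
    (div_pos (by linarith) hp1) (div_pos (by linarith) hq1) hsub
    (rellich_pohozaev_le hN hp hq ha hb hsol hu hv iv iu)
  exact fun x => ⟨eq_zero_of_integral_eq_zero hN0 cu hu hq1 iu hB x,
    eq_zero_of_integral_eq_zero hN0 cv hv hp1 iv hA x⟩
end
end

section
/- Let p, q > 0 with q > 1/3 and p > (q+1)/(3q−1). Then pq > 1, G(x) < 0 for every x ∈ [(q+1)/2, z₀), and z₀ > (q+1)/2 + 1/α, i.e. z₀ > (q+1)/2 + (pq−1)/(2(p+1)). -/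
open MeasureTheory Metric Set

noncomputable section

/-- A quartic `t⁴ + a t³ + b t² + c t + d` with `0 ≤ a` and `c, d ≤ 0` is negative at every
positive point to the left of a zero. -/
lemma quartic_neg_of_lt_root {a b c d t t₀ : ℝ} (ha : 0 ≤ a) (hc : c ≤ 0) (hd : d ≤ 0)
    (ht : 0 < t) (htt : t < t₀)
    (h₀ : t₀ ^ 4 + a * t₀ ^ 3 + b * t₀ ^ 2 + c * t₀ + d = 0) :
    t ^ 4 + a * t ^ 3 + b * t ^ 2 + c * t + d < 0 := by
  have ht₀ : 0 < t₀ := ht.trans htt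
  have hsub : 0 < t₀ - t := sub_pos.2 htt
  have key : t₀ ^ 2 * (t ^ 4 + a * t ^ 3 + b * t ^ 2 + c * t + d) =
      -((t₀ - t) * (t ^ 2 * t₀ ^ 2 * (t₀ + t) + a * (t ^ 2 * t₀ ^ 2)
        + (-c) * (t * t₀) + (-d) * (t₀ + t))) := by
    linear_combination t ^ 2 * h₀
  have hpos : 0 < t ^ 2 * t₀ ^ 2 * (t₀ + t) + a * (t ^ 2 * t₀ ^ 2)
      + (-c) * (t * t₀) + (-d) * (t₀ + t) := by
    have hc' : 0 ≤ -c := neg_nonneg.2 hc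
    have hd' : 0 ≤ -d := neg_nonneg.2 hd
    positivity
  refine neg_of_mul_neg_right ?_ (sq_nonneg t₀)
  rw [key]
  exact neg_neg_of_pos (mul_pos hsub hpos)

lemma add_sub_one_pow_four_lt {r s : ℝ} (hr : 1 < r) (hrs : r < s) (hs : s < 4 * r) :
    (s + r - 1) ^ 4 < 16 * r * s ^ 2 + 32 * r * (r - 1) * s * (s + r - 1) := by
  have key : 3 * r * (16 * r * s ^ 2 + 32 * r * (r - 1) * s * (s + r - 1) - (s + r - 1) ^ 4) =
      3 * r * ((s - r) * (4 * r - s) * (s ^ 2 + (9 * r - 4) * s + (15 * r ^ 2 - 16 * r + 6)))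
      + (48 * r ^ 4 - 48 * r ^ 3 + 8 * r ^ 2 + 8 * r - 1) * (4 * r - s)
      + (r - 1) ^ 2 * (15 * r ^ 2 + 18 * r - 1) * (s - r) := by
    ring
  have h₁ : 0 < s - r := sub_pos.2 hrs
  have h₂ : 0 < 4 * r - s := sub_pos.2 hs
  have h₃ : 0 < r - 1 := sub_pos.2 hr
  have hs₀ : 0 < s := by linarith
  have h₄ : 0 < 9 * r - 4 := by linarith
  have h₅ : 0 < 15 * r ^ 2 - 16 * r + 6 := by nlinarith [sq_nonneg (15 * r - 8)]
  have h₆ : 0 < 48 * r ^ 4 - 48 * r ^ 3 + 8 * r ^ 2 + 8 * r - 1 := by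
    have : 0 < 48 * r ^ 3 * (r - 1) := by positivity
    nlinarith [sq_nonneg r]
  have h₇ : 0 < 15 * r ^ 2 + 18 * r - 1 := by nlinarith [sq_nonneg r]
  have hpos : 0 < 3 * r * (16 * r * s ^ 2 + 32 * r * (r - 1) * s * (s + r - 1)
      - (s + r - 1) ^ 4) := by
    rw [key]
    positivity
  exact sub_pos.1 (pos_of_mul_pos_right hpos (by positivity))

lemma one_lt_mul_of_add_lt_three_mul {p q : ℝ} (hp : 0 < p) (hq : 0 < q)
    (h : p + q + 1 < 3 * (p * q)) : 1 < p * q := by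
  by_contra! hle
  nlinarith [sq_nonneg (p - q), mul_pos hp hq, add_pos hp hq]

lemma Gpoly_half_add {p q : ℝ} (hp : p + 1 ≠ 0) (t : ℝ) :
    Gpoly p q ((q + 1) / 2 + t) = t ^ 4 + 2 * (q + 1) * t ^ 3
      + (3 * (q + 1) ^ 2 / 2 - 4 * p * q * (q + 1) / (p + 1)) * t ^ 2
      + (q + 1) / (2 * (p + 1) ^ 2) * (((p + 1) * (q + 1)) * ((p + 1) * (q + 1) - 4 * (p * q))
        - 4 * (p * q) * (p * q - 1)) * t
      + (q + 1) ^ 2 / (16 * (p + 1) ^ 2) * (((p + 1) * (q + 1)) ^ 2 - (4 * (p * q)) ^ 2) := by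
  unfold Gpoly
  field_simp
  ring

lemma Gpoly_half_add_inv_alpha {p q : ℝ} (hp : p + 1 ≠ 0) :
    Gpoly p q ((q + 1) / 2 + (p * q - 1) / (2 * (p + 1))) =
      (((p + 1) * (q + 1) + p * q - 1) ^ 4 - (16 * (p * q) * ((p + 1) * (q + 1)) ^ 2
        + 32 * (p * q) * (p * q - 1) * ((p + 1) * (q + 1)) * ((p + 1) * (q + 1) + p * q - 1)))
      / (16 * (p + 1) ^ 4) := by
  unfold Gpoly
  field_simp
  ring

lemma continuous_Gpoly (p q : ℝ) : Continuous (Gpoly p q) := by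
  unfold Gpoly
  fun_prop

lemma tendsto_Gpoly_atTop (p q : ℝ) :
    Filter.Tendsto (Gpoly p q) Filter.atTop Filter.atTop := by
  set b := 4 * p * q * (q + 1) / (p + 1)
  set c := 2 * p * q * (q + 1) * (p + q + 2) / (p + 1) ^ 2
  set d := p * q * (q + 1) ^ 2 / (p + 1) ^ 2
  refine Filter.tendsto_atTop_mono' _ ?_ Filter.tendsto_id
  filter_upwards [Filter.eventually_ge_atTop (1 + |b| + |c| + |d| + 1)] with x hx
  have hb' := abs_nonneg b
  have hc' := abs_nonneg c
  have hd' := abs_nonneg d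
  have hx₁ : 1 ≤ x := by linarith
  have hx₂ : x ≤ x ^ 2 := by nlinarith
  have hx₃ : 1 ≤ x ^ 2 := hx₁.trans hx₂
  have h₁ : b * x ^ 2 ≤ |b| * x ^ 2 := by gcongr; exact le_abs_self b
  have h₂ : -(|c| * x ^ 2) ≤ c * x := by
    have : -c * x ≤ |c| * x ^ 2 := by gcongr; exact neg_le_abs c
    linarith
  have h₃ : d ≤ |d| * x ^ 2 := by nlinarith [le_abs_self d]
  have h₄ : x ^ 2 * (1 + |b| + |c| + |d|) ≤ x ^ 2 * x ^ 2 := by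
    gcongr
    linarith
  change x ≤ x ^ 4 - b * x ^ 2 + c * x - d
  nlinarith

/-- Proposition 1.7 (i): for `q > 1/3` and `p > (q+1)/(3q-1)` one has `pq > 1`,
`G < 0` on `[(q+1)/2, z₀)` and `z₀ > (q+1)/2 + 1/α`. -/
theorem stmt_4 (p q : ℝ) (hp : 0 < p) (hq : 0 < q)
    (hq3 : 1 / 3 < q) (hp' : (q + 1) / (3 * q - 1) < p)
    (z₀ : ℝ) (hroot : Gpoly p q z₀ = 0) (hmax : ∀ z : ℝ, Gpoly p q z = 0 → z ≤ z₀) :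
    1 < p * q ∧ (∀ x : ℝ, (q + 1) / 2 ≤ x → x < z₀ → Gpoly p q x < 0) ∧
    (q + 1) / 2 + (p * q - 1) / (2 * (p + 1)) < z₀ := by
  have hp1 : p + 1 ≠ 0 := by positivity
  have h3 : p + q + 1 < 3 * (p * q) := by
    rw [div_lt_iff₀ (by linarith)] at hp'
    linarith
  have hpq : 1 < p * q := one_lt_mul_of_add_lt_three_mul hp hq h3
  have hs : (p + 1) * (q + 1) < 4 * (p * q) := by linarith
  have hlow : p * q < (p + 1) * (q + 1) := by linarith
  have hs₀ : 0 < (p + 1) * (q + 1) := by positivity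
  have hconst : (q + 1) ^ 2 / (16 * (p + 1) ^ 2)
      * (((p + 1) * (q + 1)) ^ 2 - (4 * (p * q)) ^ 2) < 0 :=
    mul_neg_of_pos_of_neg (by positivity) (sub_neg.2 (by gcongr))
  have hlin : (q + 1) / (2 * (p + 1) ^ 2) * (((p + 1) * (q + 1)) *
      ((p + 1) * (q + 1) - 4 * (p * q)) - 4 * (p * q) * (p * q - 1)) < 0 := by
    refine mul_neg_of_pos_of_neg (by positivity) ?_
    have h₁ := mul_neg_of_pos_of_neg hs₀ (sub_neg.2 hs)
    have h₂ : 0 < 4 * (p * q) * (p * q - 1) := mul_pos (by positivity) (sub_pos.2 hpq)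
    linarith
  refine ⟨hpq, fun x hx hxz => ?_, ?_⟩
  · have hx' := Gpoly_half_add (q := q) hp1 (x - (q + 1) / 2)
    rw [add_sub_cancel] at hx'
    rw [hx']
    rcases hx.eq_or_lt with rfl | hlt
    · simpa using hconst
    · refine quartic_neg_of_lt_root (t₀ := z₀ - (q + 1) / 2) (by positivity) hlin.le hconst.le
        (sub_pos.2 hlt) (by linarith) ?_
      rw [← Gpoly_half_add hp1, add_sub_cancel, hroot]
  · have hneg : Gpoly p q ((q + 1) / 2 + (p * q - 1) / (2 * (p + 1))) < 0 := by
      rw [Gpoly_half_add_inv_alpha hp1]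
      exact div_neg_of_neg_of_pos (sub_neg.2 (add_sub_one_pow_four_lt hpq hlow hs)) (by positivity)
    by_contra! hle
    obtain ⟨M, hM, hMge⟩ := (((tendsto_Gpoly_atTop p q).eventually_ge_atTop 0).and
      (Filter.eventually_ge_atTop ((q + 1) / 2 + (p * q - 1) / (2 * (p + 1))))).exists
    obtain ⟨y, hy, hy₀⟩ := intermediate_value_Icc hMge (continuous_Gpoly p q).continuousOn
      ⟨hneg.le, hM⟩
    have hyb := ((hmax y hy₀).trans hle).antisymm hy.1
    rw [hyb] at hy₀
    exact hneg.ne hy₀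
end
end

section
/- Let p, q ≥ 1 with pq ≠ 1. Then p > (q+1)/(3q−1), q > 1/3, and z₀ > (q+1)/2 + 3/α, i.e. z₀ > (q+1)/2 + 3(pq−1)/(2(p+1)). -/
open MeasureTheory Metric Set

noncomputable section

theorem quartic_scaled_neg {a b : ℝ} (ha : 0 ≤ a) (hb : 0 ≤ b) (hab : 0 < a + b) (p q N : ℝ)
    (hp : p = 1 + a) (hq : q = 1 + b) (hN : N = 4 * p * q + p + q - 2) :
    N ^ 4 - 16 * p * q * (q + 1) * (p + 1) * N ^ 2 +
      16 * (p + 1) * p * q * (q + 1) * (p + q + 2) * N -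
      16 * p * q * (q + 1) ^ 2 * (p + 1) ^ 2 < 0 := by
  have hpos : 0 < 256 * (a + b) + (a * b * 1856 + a * b ^ 2 * 3216 + a * b ^ 3 * 1724 +
      a * b ^ 4 * 112 + a ^ 2 * 736 + a ^ 2 * b * 3216 + a ^ 2 * b ^ 2 * 4330 +
      a ^ 2 * b ^ 3 * 2016 + a ^ 2 * b ^ 4 * 160 + a ^ 3 * 496 + a ^ 3 * b * 1724 +
      a ^ 3 * b ^ 2 * 2016 + a ^ 3 * b ^ 3 * 848 + a ^ 3 * b ^ 4 * 64 + a ^ 4 * 15 +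
      a ^ 4 * b * 112 + a ^ 4 * b ^ 2 * 160 + a ^ 4 * b ^ 3 * 64 + b ^ 2 * 736 +
      b ^ 3 * 496 + b ^ 4 * 15) := by positivity
  subst hN hp hq
  linarith

theorem Gpoly_neg_at_threshold {p q : ℝ} (hp : 1 ≤ p) (hq : 1 ≤ q) (hpq : p * q ≠ 1) :
    Gpoly p q ((q + 1) / 2 + 3 * (p * q - 1) / (2 * (p + 1))) < 0 := by
  have hab : 0 < (p - 1) + (q - 1) := by
    by_contra h
    obtain rfl : p = 1 := by linarith
    obtain rfl : q = 1 := by linarith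
    norm_num at hpq
  have key := quartic_scaled_neg (sub_nonneg.2 hp) (sub_nonneg.2 hq) hab p q _
    (by ring) (by ring) rfl
  have hp1 : 0 < p + 1 := by linarith
  have hG : Gpoly p q ((q + 1) / 2 + 3 * (p * q - 1) / (2 * (p + 1))) =
      ((4 * p * q + p + q - 2) ^ 4 -
        16 * p * q * (q + 1) * (p + 1) * (4 * p * q + p + q - 2) ^ 2 +
        16 * (p + 1) * p * q * (q + 1) * (p + q + 2) * (4 * p * q + p + q - 2) -
        16 * p * q * (q + 1) ^ 2 * (p + 1) ^ 2) / (16 * (p + 1) ^ 4) := by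
    unfold Gpoly
    field_simp
    ring
  rw [hG]
  exact div_neg_of_neg_of_pos key (by positivity)

theorem exists_Gpoly_pos_gt {p q : ℝ} (hp : 0 ≤ p) (hq : 0 ≤ q) (x : ℝ) :
    ∃ y, x < y ∧ 0 < Gpoly p q y := by
  have hA : 0 ≤ 4 * p * q * (q + 1) / (p + 1) := by positivity
  have hB : 0 ≤ 2 * p * q * (q + 1) * (p + q + 2) / (p + 1) ^ 2 := by positivity
  have hD : 0 ≤ p * q * (q + 1) ^ 2 / (p + 1) ^ 2 := by positivity
  unfold Gpoly
  generalize 4 * p * q * (q + 1) / (p + 1) = A at *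
  generalize 2 * p * q * (q + 1) * (p + q + 2) / (p + 1) ^ 2 = B at *
  generalize p * q * (q + 1) ^ 2 / (p + 1) ^ 2 = D at *
  refine ⟨|x| + A + D + 1, by linarith [le_abs_self x], ?_⟩
  have hM : A + D + 1 ≤ |x| + A + D + 1 := by linarith [abs_nonneg x]
  generalize |x| + A + D + 1 = M at *
  have hM1 : 1 ≤ M := by linarith
  have hM2 : M ≤ M ^ 2 := by nlinarith
  have hM4 : (A + D + 1) * M ^ 2 ≤ M ^ 2 * M ^ 2 := by gcongr; linarith
  have hBM : 0 ≤ B * M := by positivity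
  have hDM : D ≤ D * M ^ 2 := le_mul_of_one_le_right hD (by linarith)
  nlinarith

/-- Proposition 1.7 (ii): for `p, q ≥ 1` with `pq ≠ 1` one has `p > (q+1)/(3q-1)`,
`q > 1/3` and `z₀ > (q+1)/2 + 3/α`. -/
theorem stmt_5 (p q : ℝ) (hp : 1 ≤ p) (hq : 1 ≤ q) (hpq : p * q ≠ 1)
    (z₀ : ℝ) (hroot : Gpoly p q z₀ = 0) (hmax : ∀ z : ℝ, Gpoly p q z = 0 → z ≤ z₀) :
    (q + 1) / (3 * q - 1) < p ∧ 1 / 3 < q ∧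
    (q + 1) / 2 + 3 * (p * q - 1) / (2 * (p + 1)) < z₀ := by
  refine ⟨?_, by linarith, ?_⟩
  · have hpos : 0 < (p - 1) + (q - 1) := by
      by_contra h
      obtain rfl : p = 1 := by linarith
      obtain rfl : q = 1 := by linarith
      norm_num at hpq
    rw [div_lt_iff₀ (by linarith)]
    nlinarith [mul_nonneg (sub_nonneg.2 hp) (sub_nonneg.2 hq)]
  · have hneg := Gpoly_neg_at_threshold hp hq hpq
    set x := (q + 1) / 2 + 3 * (p * q - 1) / (2 * (p + 1))
    obtain ⟨y, hxy, hy⟩ := exists_Gpoly_pos_gt (zero_le_one.trans hp) (zero_le_one.trans hq) x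
    have hcont : ContinuousOn (Gpoly p q) (Icc x y) := by
      unfold Gpoly
      fun_prop
    obtain ⟨z, hz, hz0⟩ := intermediate_value_Ioo hxy.le hcont ⟨hneg, hy⟩
    exact hz.1.trans_le (hmax z hz0)
end
end
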